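/- Let C ≥ 1, λ > 0, Λ > 0, let p : (0,1]×ℝ^d×ℝ^d → [0,∞) be measurable with p(t,x,y) ≤ C·(Γ_λ(t; x−y) + η(t; x−y)) for all t ∈ (0,1] and x,y ∈ ℝ^d, let μ be a nonnegative Borel measure on ℝ^d, let G : ℝ^d×ℝ^d → [0,∞) be bounded measurable, and let c : ℝ^d×ℝ^d → [0,Λ] be measurable. Define q⁽⁰⁾ := p and, for k ≥ 1, q⁽ᵏ⁾(t,x,y) := ∫₀^t ∫_{ℝ^d} p(t−s,x,z)·q⁽ᵏ⁻¹⁾(s,z,y) μ(dz) ds + ∫₀^t ∫_{ℝ^d×ℝ^d} p(t−s,x,z)·q⁽ᵏ⁻¹⁾(s,w,y)·c(z,w)·G(z,w)/|z−w|^{d+α} dz dw ds. Then there exist constants M ≥ 1 and γ > 0, depending only on d, α, C, λ, Λ and ‖G‖_∞, such that whenever t₁ ∈ (0,1] satisfies N_μ^{α,λ/3}(t₁) + N_G^{α,λ/3}(t₁) ≤ 1/(2M), then for every t ∈ (0,t₁] and all x, y ∈ ℝ^d the series Σ_{k=0}^∞ q⁽ᵏ⁾(t,x,y) converges and satisfies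 Σ_{k=0}^∞ q⁽ᵏ⁾(t,x,y) ≤ γ·p_{2λ/3}(t,x,y). -/

import Mathlib

open MeasureTheory Set ENNReal

noncomputable def Gam (d : ℕ) (lam t : ℝ) (x : EuclideanSpace ℝ (Fin d)) : ℝ :=
  t ^ (-(d : ℝ) / 2) * Real.exp (-lam * ‖x‖ ^ 2 / t)

noncomputable def eta (d : ℕ) (α t : ℝ) (x : EuclideanSpace ℝ (Fin d)) : ℝ :=
  t / (t ^ ((1 : ℝ) / 2) + ‖x‖) ^ ((d : ℝ) + α)

noncomputable def pc (d : ℕ) (α c t : ℝ) (x y : EuclideanSpace ℝ (Fin d)) : ℝ :=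
  Gam d c t (x - y) + eta d α t (x - y)

noncomputable def Nmu (d : ℕ) (α lam : ℝ) (μ : Measure (EuclideanSpace ℝ (Fin d)))
    (t : ℝ) : ℝ≥0∞ :=
  ⨆ x : EuclideanSpace ℝ (Fin d), ∫⁻ s in Set.Ioc (0 : ℝ) t, ∫⁻ y,
    ENNReal.ofReal (Gam d lam s (x - y) + eta d α s (x - y)) ∂μ

noncomputable def NF (d : ℕ) (α lam : ℝ)
    (G : EuclideanSpace ℝ (Fin d) → EuclideanSpace ℝ (Fin d) → ℝ) (t : ℝ) : ℝ≥0∞ :=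
  ⨆ y : EuclideanSpace ℝ (Fin d), ∫⁻ s in Set.Ioc (0 : ℝ) t,
    ∫⁻ zw : EuclideanSpace ℝ (Fin d) × EuclideanSpace ℝ (Fin d),
      ENNReal.ofReal ((Gam d lam s (y - zw.1) + eta d α s (y - zw.1)) *
        (G zw.1 zw.2 + G zw.2 zw.1) / ‖zw.1 - zw.2‖ ^ ((d : ℝ) + α))



noncomputable def gg (d : ℕ) (c t r : ℝ) : ℝ := t ^ (-(d : ℝ) / 2) * Real.exp (-c * r ^ 2 / t)
noncomputable def hh (β t r : ℝ) : ℝ := t / (t ^ ((1 : ℝ) / 2) + r) ^ β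
noncomputable def PP (d : ℕ) (β c t r : ℝ) : ℝ := gg d c t r + hh β t r

lemma gg_nonneg {d : ℕ} {c t r : ℝ} (ht : 0 < t) : 0 ≤ gg d c t r := by
  unfold gg; positivity

lemma hh_pos {β t r : ℝ} (ht : 0 < t) (hr : 0 ≤ r) : 0 < hh β t r := by
  unfold hh; positivity

lemma PP_pos {d : ℕ} {β c t r : ℝ} (ht : 0 < t) (hr : 0 ≤ r) : 0 < PP d β c t r :=
  add_pos_of_nonneg_of_pos (gg_nonneg ht) (hh_pos ht hr)

lemma gg_anti {d : ℕ} {c c' t r r' : ℝ} (ht : 0 < t) (hc : 0 ≤ c) (hcc : c ≤ c') (hr : 0 ≤ r)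
    (hrr : r ≤ r') : gg d c' t r' ≤ gg d c t r := by
  unfold gg
  apply mul_le_mul_of_nonneg_left _ (by positivity)
  apply Real.exp_le_exp.mpr
  apply div_le_div_of_nonneg_right _ ht.le
  have h1 : r ^ 2 ≤ r' ^ 2 := by gcongr
  have : c * r ^ 2 ≤ c' * r' ^ 2 := mul_le_mul hcc h1 (by positivity) (by linarith)
  linarith

lemma exp_poly (k c : ℝ) (hk : 0 < k) (hc : 0 < c) :
    ∃ K : ℝ, 0 < K ∧ ∀ x : ℝ, 0 ≤ x → x ^ k * Real.exp (-c * x) ≤ K := by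
  refine ⟨(k / c) ^ k, by positivity, fun x hx => ?_⟩
  have h1 : x ≤ (k / c) * Real.exp (c * x / k) := by
    have := Real.add_one_le_exp (c * x / k)
    calc x = (k / c) * (c * x / k) := by field_simp
      _ ≤ _ := by gcongr; linarith
  have h2 : x ^ k ≤ (k / c) ^ k * Real.exp (c * x) := by
    calc x ^ k ≤ ((k / c) * Real.exp (c * x / k)) ^ k := Real.rpow_le_rpow hx h1 hk.le
      _ = _ := by
        rw [Real.mul_rpow (by positivity) (by positivity), ← Real.exp_mul]
        congr 2; field_simp
  calc x ^ k * Real.exp (-c * x) ≤ ((k / c) ^ k * Real.exp (c * x)) * Real.exp (-c * x) := by gcongr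
    _ = (k / c) ^ k := by rw [mul_assoc, ← Real.exp_add]; simp

lemma time_comp (d : ℕ) (hd : 2 ≤ d) (c : ℝ) (hc : 0 < c) :
    ∃ K : ℝ, 0 < K ∧ ∀ u t : ℝ, 0 < u → u ≤ t →
      u ^ (-(d : ℝ) / 2) * Real.exp (-c * (t / u)) ≤ K * t ^ (-(d : ℝ) / 2) := by
  have hd' : (0 : ℝ) < (d : ℝ) / 2 := by
    have : (2 : ℝ) ≤ d := by exact_mod_cast hd
    linarith
  obtain ⟨K, hK, h⟩ := exp_poly ((d : ℝ) / 2) c hd' hc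
  refine ⟨K, hK, fun u t hu hut => ?_⟩
  have ht : 0 < t := by linarith
  have h1 := h (t / u) (by positivity)
  have h2 : u ^ (-(d : ℝ) / 2) = (t / u) ^ ((d : ℝ) / 2) * t ^ (-(d : ℝ) / 2) := by
    rw [Real.div_rpow ht.le hu.le, neg_div, Real.rpow_neg hu.le, Real.rpow_neg ht.le]
    have := Real.rpow_pos_of_pos ht ((d : ℝ) / 2)
    field_simp
  rw [h2]
  calc _ = ((t / u) ^ ((d : ℝ) / 2) * Real.exp (-c * (t / u))) * t ^ (-(d : ℝ) / 2) := by ring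
    _ ≤ _ := by gcongr

lemma time_comp4 (d : ℕ) {u t : ℝ} (hu : 0 < u) (htu : t ≤ 4 * u) (ht : 0 < t) :
    u ^ (-(d : ℝ) / 2) ≤ 4 ^ ((d : ℝ) / 2) * t ^ (-(d : ℝ) / 2) := by
  rw [neg_div, Real.rpow_neg hu.le, Real.rpow_neg ht.le]
  have h1 := Real.rpow_le_rpow ht.le htu (show 0 ≤ (d : ℝ) / 2 by positivity)
  rw [Real.mul_rpow (by norm_num) hu.le] at h1
  have a1 := Real.rpow_pos_of_pos ht ((d : ℝ) / 2)
  have a2 := Real.rpow_pos_of_pos hu ((d : ℝ) / 2)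
  rw [← div_eq_mul_inv, inv_eq_one_div, div_le_div_iff₀ a2 a1]
  linarith

lemma hh_comp {β s t b r K : ℝ} (hβ : 0 < β) (hs : 0 < s) (hst : s ≤ t) (hb : 0 ≤ b) (hr : 0 ≤ r)
    (hK : 0 < K)
    (h : t ^ ((1 : ℝ) / 2) + r ≤ K * (s ^ ((1 : ℝ) / 2) + b)) : hh β s b ≤ K ^ β * hh β t r := by
  have ht : 0 < t := by linarith
  unfold hh
  have h1 := Real.rpow_le_rpow (by positivity) h hβ.le
  rw [Real.mul_rpow hK.le (by positivity)] at h1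
  rw [mul_div_assoc', div_le_div_iff₀ (by positivity) (by positivity)]
  calc _ ≤ t * (K ^ β * (s ^ ((1 : ℝ) / 2) + b) ^ β) := by gcongr
    _ = _ := by ring

lemma hh_div {β t r : ℝ} (ht : 0 < t) : hh β t r / t = ((t ^ ((1 : ℝ) / 2) + r) ^ β)⁻¹ := by
  unfold hh; field_simp

lemma sqrt_le {t r : ℝ} (hr : 0 ≤ r) (h : t ≤ r ^ 2) : t ^ ((1 : ℝ) / 2) ≤ r := by
  rw [← Real.sqrt_eq_rpow]; exact Real.sqrt_le_iff.mpr ⟨hr, h⟩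

lemma exp_absorb (β c : ℝ) (hβ : 0 < β) (hc : 0 < c) :
    ∃ K : ℝ, 0 < K ∧ ∀ t r : ℝ, 0 < t → 0 < r → t ≤ r ^ 2 →
      (r / t) ^ β * Real.exp (-c * (r ^ 2 / t)) ≤ K * (hh β t r / t) := by
  obtain ⟨K, hK, h⟩ := exp_poly β c hβ hc
  refine ⟨2 ^ β * K, by positivity, fun t r ht hr htr => ?_⟩
  have h1 := h (r ^ 2 / t) (by positivity)
  have h2 := sqrt_le hr.le htr
  rw [hh_div ht, ← div_eq_mul_inv, le_div_iff₀ (by positivity)]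
  have h3 : (t ^ ((1 : ℝ) / 2) + r) ^ β ≤ 2 ^ β * r ^ β := by
    rw [← Real.mul_rpow (by norm_num) hr.le]
    apply Real.rpow_le_rpow (by positivity) (by linarith) hβ.le
  calc _ ≤ (r / t) ^ β * Real.exp (-c * (r ^ 2 / t)) * (2 ^ β * r ^ β) := by gcongr
    _ = 2 ^ β * (((r / t) ^ β * r ^ β) * Real.exp (-c * (r ^ 2 / t))) := by ring
    _ = 2 ^ β * ((r ^ 2 / t) ^ β * Real.exp (-c * (r ^ 2 / t))) := by
      rw [← Real.mul_rpow (by positivity) hr.le, show r / t * r = r ^ 2 / t by ring]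
    _ ≤ _ := by gcongr

lemma titu {a b u v : ℝ} (hu : 0 < u) (hv : 0 < v) :
    (a + b) ^ 2 / (u + v) ≤ a ^ 2 / u + b ^ 2 / v := by
  rw [div_add_div _ _ hu.ne' hv.ne', div_le_div_iff₀ (by positivity) (by positivity)]
  nlinarith [sq_nonneg (a * v - b * u)]

lemma threeP_gg (d : ℕ) {lam u s a b : ℝ} (hlam : 0 < lam) (hu : 0 < u) (hs : 0 < s) :
    gg d lam u a * gg d (2 * lam / 3) s b ≤ 4 ^ ((d : ℝ) / 2) * gg d (2 * lam / 3) (u + s) (a + b) *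
      (gg d (lam / 3) u a + gg d (lam / 3) s b) := by
  have ht : 0 < u + s := by linarith
  have key : gg d lam u a * gg d (2 * lam / 3) s b ≤
      4 ^ ((d : ℝ) / 2) * gg d (2 * lam / 3) (u + s) (a + b) * gg d (lam / 3) u a ∨
      gg d lam u a * gg d (2 * lam / 3) s b ≤
      4 ^ ((d : ℝ) / 2) * gg d (2 * lam / 3) (u + s) (a + b) * gg d (lam / 3) s b := by
    rcases le_total (s * 4) (u + s) with h | h
    · right
      have h1 := time_comp4 d hu (show u + s ≤ 4 * u by linarith) ht
      have h2 : Real.exp (-lam * a ^ 2 / u) * Real.exp (-(2 * lam / 3) * b ^ 2 / s) ≤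
          Real.exp (-(2 * lam / 3) * (a + b) ^ 2 / (u + s)) * Real.exp (-(lam / 3) * b ^ 2 / s) := by
        rw [← Real.exp_add, ← Real.exp_add]
        apply Real.exp_le_exp.mpr
        have t1 := titu (a := a) (b := b) hu (show 0 < 3 * s by linarith)
        have t2 : (2 / 3) * ((a + b) ^ 2 / (u + s)) ≤ (a + b) ^ 2 / (u + 3 * s) := by
          rw [mul_div_assoc', div_le_div_iff₀ (by positivity) (by positivity)]
          nlinarith [sq_nonneg (a + b)]
        have t3 := mul_le_mul_of_nonneg_left (t2.trans t1) hlam.le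
        have e1 : b ^ 2 / (3 * s) = (b ^ 2 / s) / 3 := by field_simp
        rw [e1] at t3
        simp only [neg_mul, neg_div, mul_div_assoc] at t3 ⊢
        linarith
      unfold gg
      calc _ = u ^ (-(d : ℝ) / 2) * s ^ (-(d : ℝ) / 2) *
            (Real.exp (-lam * a ^ 2 / u) * Real.exp (-(2 * lam / 3) * b ^ 2 / s)) := by ring
        _ ≤ (4 ^ ((d : ℝ) / 2) * (u + s) ^ (-(d : ℝ) / 2)) * s ^ (-(d : ℝ) / 2) *
            (Real.exp (-(2 * lam / 3) * (a + b) ^ 2 / (u + s)) * Real.exp (-(lam / 3) * b ^ 2 / s)) := by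
          gcongr
        _ = _ := by ring
    · left
      have h1 := time_comp4 d hs (show u + s ≤ 4 * s by linarith) ht
      have h2 : Real.exp (-lam * a ^ 2 / u) * Real.exp (-(2 * lam / 3) * b ^ 2 / s) ≤
          Real.exp (-(2 * lam / 3) * (a + b) ^ 2 / (u + s)) * Real.exp (-(lam / 3) * a ^ 2 / u) := by
        rw [← Real.exp_add, ← Real.exp_add]
        apply Real.exp_le_exp.mpr
        have t3 := mul_le_mul_of_nonneg_left (titu (a := a) (b := b) hu hs) hlam.le
        simp only [neg_mul, neg_div, mul_div_assoc] at t3 ⊢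
        linarith
      unfold gg
      calc _ = s ^ (-(d : ℝ) / 2) * u ^ (-(d : ℝ) / 2) *
            (Real.exp (-lam * a ^ 2 / u) * Real.exp (-(2 * lam / 3) * b ^ 2 / s)) := by ring
        _ ≤ (4 ^ ((d : ℝ) / 2) * (u + s) ^ (-(d : ℝ) / 2)) * u ^ (-(d : ℝ) / 2) *
            (Real.exp (-(2 * lam / 3) * (a + b) ^ 2 / (u + s)) * Real.exp (-(lam / 3) * a ^ 2 / u)) := by
          gcongr
        _ = _ := by ring
  have p1 := gg_nonneg (d := d) (c := lam / 3) (r := a) hu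
  have p2 := gg_nonneg (d := d) (c := lam / 3) (r := b) hs
  have p3 := gg_nonneg (d := d) (c := 2 * lam / 3) (r := a + b) ht
  have p4 : 0 ≤ 4 ^ ((d : ℝ) / 2) * gg d (2 * lam / 3) (u + s) (a + b) := by positivity
  rcases key with h | h <;> nlinarith [mul_nonneg p4 p1, mul_nonneg p4 p2]

lemma sqrt_add_le {u s : ℝ} (hu : 0 < u) (hs : 0 < s) :
    (u + s) ^ ((1 : ℝ) / 2) ≤ u ^ ((1 : ℝ) / 2) + s ^ ((1 : ℝ) / 2) := by
  simp only [← Real.sqrt_eq_rpow]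
  have h1 := Real.sqrt_nonneg u
  have h2 := Real.sqrt_nonneg s
  refine Real.sqrt_le_iff.mpr ⟨by positivity, ?_⟩
  nlinarith [Real.sq_sqrt hu.le, Real.sq_sqrt hs.le]

lemma threeP_hh {β u s a b : ℝ} (hβ : 0 < β) (hu : 0 < u) (hs : 0 < s) (ha : 0 ≤ a) (hb : 0 ≤ b) :
    hh β u a * hh β s b ≤ 2 ^ β * hh β (u + s) (a + b) * (hh β u a + hh β s b) := by
  have h0 := sqrt_add_le hu hs
  have p1 := hh_pos (β := β) hu ha
  have p2 := hh_pos (β := β) hs hb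
  have p3 := hh_pos (β := β) (add_pos hu hs) (add_nonneg ha hb)
  have p4 : 0 ≤ 2 ^ β * hh β (u + s) (a + b) := by positivity
  rcases le_total (u ^ ((1 : ℝ) / 2) + a) (s ^ ((1 : ℝ) / 2) + b) with h | h
  · have := hh_comp hβ hs (show s ≤ u + s by linarith) hb (add_nonneg ha hb) two_pos (by linarith)
    nlinarith [mul_nonneg p4 p2.le, mul_le_mul_of_nonneg_left this p1.le]
  · have := hh_comp hβ hu (show u ≤ u + s by linarith) ha (add_nonneg ha hb) two_pos (by linarith)
    nlinarith [mul_nonneg p4 p1.le, mul_le_mul_of_nonneg_left this p2.le]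


lemma gg_time (d : ℕ) (hd : 2 ≤ d) (c e : ℝ) (he : 0 < e) :
    ∃ K : ℝ, 0 < K ∧ ∀ u t a r : ℝ, 0 < u → u ≤ t → 0 ≤ c → t ≤ r ^ 2 →
      ∀ c' : ℝ, c * r ^ 2 / t + e * (t / u) ≤ c' * a ^ 2 / u → gg d c' u a ≤ K * gg d c t r := by
  obtain ⟨K, hK, h⟩ := time_comp d hd e he
  refine ⟨K, hK, fun u t a r hu hut hc htr c' hh' => ?_⟩
  unfold gg
  have h1 := h u t hu hut
  have h2 : Real.exp (-c' * a ^ 2 / u) ≤ Real.exp (-e * (t / u)) * Real.exp (-c * r ^ 2 / t) := by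
    rw [← Real.exp_add]
    apply Real.exp_le_exp.mpr
    simp only [neg_mul, neg_div] at hh' ⊢
    linarith
  calc _ ≤ u ^ (-(d : ℝ) / 2) * (Real.exp (-e * (t / u)) * Real.exp (-c * r ^ 2 / t)) := by gcongr
    _ = (u ^ (-(d : ℝ) / 2) * Real.exp (-e * (t / u))) * Real.exp (-c * r ^ 2 / t) := by ring
    _ ≤ (K * t ^ (-(d : ℝ) / 2)) * Real.exp (-c * r ^ 2 / t) := by gcongr
    _ = _ := by ring

/-- comparison for comparable times. -/
lemma gg_time4 (d : ℕ) {c c' e u t a r : ℝ} (hu : 0 < u) (ht : 0 < t) (htu : t ≤ 4 * u)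
    (h : c * r ^ 2 / t ≤ c' * a ^ 2 / u + e) :
    gg d c' u a ≤ (4 ^ ((d : ℝ) / 2) * Real.exp e) * gg d c t r := by
  unfold gg
  have h1 := time_comp4 d hu htu ht
  have h2 : Real.exp (-c' * a ^ 2 / u) ≤ Real.exp e * Real.exp (-c * r ^ 2 / t) := by
    rw [← Real.exp_add]
    apply Real.exp_le_exp.mpr
    simp only [neg_mul, neg_div] at h ⊢
    linarith
  calc _ ≤ (4 ^ ((d : ℝ) / 2) * t ^ (-(d : ℝ) / 2)) * (Real.exp e * Real.exp (-c * r ^ 2 / t)) := by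
        gcongr
    _ = _ := by ring

/-- comparison for jump kernel in the small-distance case. -/
lemma hh_small {β s t b r : ℝ} (hβ : 0 < β) (hs : 0 < s) (hst : s ≤ t) (hts : t ≤ 4 * s)
    (hb : 0 ≤ b) (hr : 0 ≤ r) (hrt : r ^ 2 ≤ t) : hh β s b ≤ 4 ^ β * hh β t r := by
  apply hh_comp hβ hs hst hb hr (by norm_num)
  simp only [← Real.sqrt_eq_rpow]
  have h1 : r ≤ √t := Real.le_sqrt_of_sq_le hrt
  have h2 : √t ≤ 2 * √s := by
    rw [show (2 : ℝ) * √s = √(4 * s) by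
      rw [Real.sqrt_mul (by norm_num), show (4 : ℝ) = 2 ^ 2 by norm_num, Real.sqrt_sq (by norm_num)]]
    exact Real.sqrt_le_sqrt hts
  linarith

lemma hh_large {β s t b r K : ℝ} (hβ : 0 < β) (hs : 0 < s) (hst : s ≤ t)
    (hb : 0 ≤ b) (hr : 0 ≤ r) (hK : 0 < K) (hrt : t ≤ r ^ 2) (hbr : 2 * r ≤ K * b) :
    hh β s b ≤ K ^ β * hh β t r := by
  apply hh_comp hβ hs hst hb hr hK
  have := sqrt_le hr hrt
  have h2 : 0 ≤ s ^ ((1 : ℝ) / 2) := by positivity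
  nlinarith

lemma threeP_gh (d : ℕ) (hd : 2 ≤ d) (β lam : ℝ) (hβ : 0 < β) (hlam : 0 < lam) :
    ∃ K : ℝ, 0 < K ∧ ∀ u s a b : ℝ, 0 < u → 0 < s → 0 ≤ a → 0 ≤ b →
      gg d lam u a * hh β s b ≤ K * (gg d (2 * lam / 3) (u + s) (a + b) * hh β s b +
        hh β (u + s) (a + b) * gg d lam u a) := by
  obtain ⟨K1, hK1, h1⟩ := gg_time d hd (2 * lam / 3) (lam / 10) (by linarith)
  refine ⟨K1 + 4 ^ ((d : ℝ) / 2) * Real.exp (2 * lam / 3) + 4 ^ β + 20 ^ β, by positivity,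
    fun u s a b hu hs ha hb => ?_⟩
  have ht : 0 < u + s := by linarith
  have hr : 0 ≤ a + b := by linarith
  have p1 := gg_nonneg (d := d) (c := lam) (r := a) hu
  have p2 := gg_nonneg (d := d) (c := 2 * lam / 3) (r := a + b) ht
  have p3 := (hh_pos (β := β) hs hb).le
  have p4 := (hh_pos (β := β) ht hr).le
  have q1 : 0 < 4 ^ ((d : ℝ) / 2) * Real.exp (2 * lam / 3) := by positivity
  have q2 : (0 : ℝ) < 4 ^ β := by positivity
  have q3 : (0 : ℝ) < 20 ^ β := by positivity
  have useG : ∀ K', 0 < K' → K' ≤ K1 + 4 ^ ((d : ℝ) / 2) * Real.exp (2 * lam / 3) + 4 ^ β + 20 ^ β →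
      gg d lam u a ≤ K' * gg d (2 * lam / 3) (u + s) (a + b) →
      gg d lam u a * hh β s b ≤ (K1 + 4 ^ ((d : ℝ) / 2) * Real.exp (2 * lam / 3) + 4 ^ β + 20 ^ β) *
      (gg d (2 * lam / 3) (u + s) (a + b) * hh β s b + hh β (u + s) (a + b) * gg d lam u a) := by
    intro K' h0 hK' h
    calc _ ≤ (K' * gg d (2 * lam / 3) (u + s) (a + b)) * hh β s b := by gcongr
      _ = K' * (gg d (2 * lam / 3) (u + s) (a + b) * hh β s b) := by ring
      _ ≤ _ := by gcongr; nlinarith [mul_nonneg p4 p1]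
  have useH : ∀ K', 0 < K' → K' ≤ K1 + 4 ^ ((d : ℝ) / 2) * Real.exp (2 * lam / 3) + 4 ^ β + 20 ^ β →
      hh β s b ≤ K' * hh β (u + s) (a + b) →
      gg d lam u a * hh β s b ≤ (K1 + 4 ^ ((d : ℝ) / 2) * Real.exp (2 * lam / 3) + 4 ^ β + 20 ^ β) *
      (gg d (2 * lam / 3) (u + s) (a + b) * hh β s b + hh β (u + s) (a + b) * gg d lam u a) := by
    intro K' h0 hK' h
    calc _ ≤ gg d lam u a * (K' * hh β (u + s) (a + b)) := by gcongr
      _ = K' * (hh β (u + s) (a + b) * gg d lam u a) := by ring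
      _ ≤ _ := by gcongr; nlinarith [mul_nonneg p2 p3]
  rcases le_total ((a + b) ^ 2) (u + s) with h | h
  · rcases le_total u s with hus | hus
    · exact useH _ q2 (by linarith) (hh_small hβ hs (by linarith) (by linarith) hb hr h)
    · refine useG _ q1 (by linarith) (gg_time4 d hu ht (by linarith) ?_)
      have : (a + b) ^ 2 / (u + s) ≤ 1 := by rw [div_le_one ht]; exact h
      have : 0 ≤ lam * a ^ 2 / u := by positivity
      rw [mul_div_assoc]; nlinarith
  · rcases le_total (a + b) (10 * b) with hb' | hb'
    · exact useH _ q3 (by linarith) (hh_large hβ hs (by linarith) hb hr (by norm_num) h (by linarith))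
    · refine useG _ hK1 (by linarith) (h1 u (u + s) a (a + b) hu (by linarith) (by linarith) h _ ?_)
      have e1 : (a + b) ^ 2 / (u + s) ≤ (a + b) ^ 2 / u := by gcongr; linarith
      have e2 : (u + s) / u ≤ (a + b) ^ 2 / u := by gcongr
      have e3 : (2 / 3 + 1 / 10) * ((a + b) ^ 2 / u) ≤ a ^ 2 / u := by
        rw [mul_div_assoc']; gcongr; nlinarith
      have := mul_le_mul_of_nonneg_left e3 hlam.le
      have := mul_le_mul_of_nonneg_left e1 hlam.le
      have := mul_le_mul_of_nonneg_left e2 hlam.le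
      simp only [mul_div_assoc] at *
      linarith

lemma threeP_hg (d : ℕ) (hd : 2 ≤ d) (β lam : ℝ) (hβ : 0 < β) (hlam : 0 < lam) :
    ∃ K : ℝ, 0 < K ∧ ∀ u s a b : ℝ, 0 < u → 0 < s → 0 ≤ a → 0 ≤ b →
      hh β u a * gg d (2 * lam / 3) s b ≤ K * (gg d (2 * lam / 3) (u + s) (a + b) * hh β u a +
        hh β (u + s) (a + b) * gg d (lam / 3) s b) := by
  obtain ⟨K1, hK1, h1⟩ := gg_time d hd (2 * lam / 3) (lam / 10) (by linarith)
  obtain ⟨K2, hK2, h2⟩ := exp_absorb β (lam / 10) hβ (by linarith)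
  obtain ⟨KK, hKK⟩ : ∃ KK, KK = K1 + 4 ^ ((d : ℝ) / 2) * Real.exp (4 * lam / 3) + 4 ^ β + 20 ^ β + K2 :=
    ⟨_, rfl⟩
  have q1 : 0 < 4 ^ ((d : ℝ) / 2) * Real.exp (4 * lam / 3) := by positivity
  have q2 : (0 : ℝ) < 4 ^ β := by positivity
  have q3 : (0 : ℝ) < 20 ^ β := by positivity
  have hKK0 : 0 < KK := by rw [hKK]; positivity
  refine ⟨KK, hKK0, fun u s a b hu hs ha hb => ?_⟩
  have ht : 0 < u + s := by linarith
  have hr : 0 ≤ a + b := by linarith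
  have p0 := gg_nonneg (d := d) (c := 2 * lam / 3) (r := b) hs
  have p1 := gg_nonneg (d := d) (c := lam / 3) (r := b) hs
  have p2 := gg_nonneg (d := d) (c := 2 * lam / 3) (r := a + b) ht
  have p3 := (hh_pos (β := β) hu ha).le
  have p4 := (hh_pos (β := β) ht hr).le
  have p5 : gg d (2 * lam / 3) s b ≤ gg d (lam / 3) s b :=
    gg_anti hs (by linarith) (by linarith) hb le_rfl
  have useG : ∀ K', 0 < K' → K' ≤ KK →
      gg d (2 * lam / 3) s b ≤ K' * gg d (2 * lam / 3) (u + s) (a + b) →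
      hh β u a * gg d (2 * lam / 3) s b ≤ KK * (gg d (2 * lam / 3) (u + s) (a + b) * hh β u a +
        hh β (u + s) (a + b) * gg d (lam / 3) s b) := by
    intro K' h0 hK' h
    calc _ ≤ hh β u a * (K' * gg d (2 * lam / 3) (u + s) (a + b)) := by gcongr
      _ = K' * (gg d (2 * lam / 3) (u + s) (a + b) * hh β u a) := by ring
      _ ≤ _ := by gcongr; nlinarith [mul_nonneg p4 p1]
  have useHG : ∀ K', 0 < K' → K' ≤ KK →
      hh β u a * gg d (2 * lam / 3) s b ≤ K' * (hh β (u + s) (a + b) * gg d (lam / 3) s b) →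
      hh β u a * gg d (2 * lam / 3) s b ≤ KK * (gg d (2 * lam / 3) (u + s) (a + b) * hh β u a +
        hh β (u + s) (a + b) * gg d (lam / 3) s b) := by
    intro K' h0 hK' h
    refine h.trans ?_
    gcongr; nlinarith [mul_nonneg p2 p3]
  have useH : ∀ K', 0 < K' → K' ≤ KK →
      hh β u a ≤ K' * hh β (u + s) (a + b) →
      hh β u a * gg d (2 * lam / 3) s b ≤ KK * (gg d (2 * lam / 3) (u + s) (a + b) * hh β u a +
        hh β (u + s) (a + b) * gg d (lam / 3) s b) := by
    intro K' h0 hK' h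
    apply useHG K' h0 hK'
    calc _ ≤ (K' * hh β (u + s) (a + b)) * gg d (lam / 3) s b := by gcongr
      _ = _ := by ring
  rcases le_total ((a + b) ^ 2) (u + s) with h | h
  · rcases le_total s u with hus | hus
    · exact useH _ q2 (by linarith) (hh_small hβ hu (by linarith) (by linarith) ha hr h)
    · refine useG _ q1 (by linarith) (gg_time4 d hs ht (by linarith) ?_)
      have : (a + b) ^ 2 / (u + s) ≤ 1 := by rw [div_le_one ht]; exact h
      have : 0 ≤ 2 * lam / 3 * b ^ 2 / s := by positivity
      rw [mul_div_assoc]; nlinarith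
  · have hr0 : 0 < a + b := by
      rcases hr.lt_or_eq with h' | h'
      · exact h'
      · rw [← h'] at h; norm_num at h; linarith
    rcases le_total (a + b) (10 * a) with hb' | hb'
    · exact useH _ q3 (by linarith) (hh_large hβ hu (by linarith) ha hr (by norm_num) h (by linarith))
    · rcases le_total (a * (a + b)) (u + s) with hA | hA
      · rcases le_total u s with hus | hus
        · refine useG _ q1 (by linarith) (gg_time4 d hs ht (by linarith) ?_)
          have e1 : b ^ 2 / (u + s) ≤ b ^ 2 / s := by gcongr; linarith
          have e2 : (a + b) ^ 2 / (u + s) ≤ b ^ 2 / (u + s) + 2 := by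
            rw [div_le_iff₀ ht, add_mul, div_mul_cancel₀ _ ht.ne']
            nlinarith
          have := mul_le_mul_of_nonneg_left (e2.trans (add_le_add_left e1 2)) hlam.le
          simp only [mul_div_assoc] at *
          linarith
        · refine useG _ hK1 (by linarith)
            (h1 s (u + s) b (a + b) hs (by linarith) (by linarith) h _ ?_)
          have e1 : (a + b) ^ 2 / (u + s) ≤ ((a + b) ^ 2 / s) / 2 := by
            rw [div_div]; gcongr; linarith
          have e2 : (u + s) / s ≤ (a + b) ^ 2 / s := by gcongr
          have e3 : (81 / 100) * ((a + b) ^ 2 / s) ≤ b ^ 2 / s := by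
            rw [mul_div_assoc']; gcongr; nlinarith
          have := mul_le_mul_of_nonneg_left e3 hlam.le
          have := mul_le_mul_of_nonneg_left e1 hlam.le
          have := mul_le_mul_of_nonneg_left e2 hlam.le
          have : 0 ≤ lam * ((a + b) ^ 2 / s) := by positivity
          simp only [mul_div_assoc] at *
          linarith
      · apply useHG K2 hK2 (by linarith)
        have ha0 : 0 < a := by
          by_contra hcon
          have : a = 0 := le_antisymm (not_lt.mp hcon) ha
          rw [this] at hA; linarith
        have f1 : hh β u a ≤ (u + s) * ((a + b) / (u + s)) ^ β := by
          unfold hh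
          rw [Real.div_rpow hr ht.le, mul_div_assoc', div_le_div_iff₀ (by positivity) (by positivity)]
          have g1 : (u + s) ^ β ≤ (a + b) ^ β * (u ^ ((1 : ℝ) / 2) + a) ^ β := by
            rw [← Real.mul_rpow hr (by positivity)]
            apply Real.rpow_le_rpow ht.le _ hβ.le
            have : 0 ≤ u ^ ((1 : ℝ) / 2) := by positivity
            nlinarith
          calc u * (u + s) ^ β ≤ (u + s) * ((a + b) ^ β * (u ^ ((1 : ℝ) / 2) + a) ^ β) := by
                gcongr; linarith
            _ = _ := by ring
        have f2 : gg d (2 * lam / 3) s b ≤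
            Real.exp (-(lam / 10) * ((a + b) ^ 2 / (u + s))) * gg d (lam / 3) s b := by
          unfold gg
          rw [mul_left_comm, ← Real.exp_add]
          gcongr
          have e1 : (a + b) ^ 2 / (u + s) ≤ (a + b) ^ 2 / s := by gcongr; linarith
          have e3 : (81 / 100) * ((a + b) ^ 2 / s) ≤ b ^ 2 / s := by
            rw [mul_div_assoc']; gcongr; nlinarith
          have := mul_le_mul_of_nonneg_left e3 hlam.le
          have := mul_le_mul_of_nonneg_left e1 hlam.le
          have : 0 ≤ lam * ((a + b) ^ 2 / s) := by positivity
          simp only [neg_mul, neg_div, mul_div_assoc] at *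
          linarith
        have f3 := h2 (u + s) (a + b) ht hr0 h
        calc _ ≤ ((u + s) * ((a + b) / (u + s)) ^ β) *
              (Real.exp (-(lam / 10) * ((a + b) ^ 2 / (u + s))) * gg d (lam / 3) s b) := by gcongr
          _ = (u + s) * (((a + b) / (u + s)) ^ β *
              Real.exp (-(lam / 10) * ((a + b) ^ 2 / (u + s)))) * gg d (lam / 3) s b := by ring
          _ ≤ (u + s) * (K2 * (hh β (u + s) (a + b) / (u + s))) * gg d (lam / 3) s b := by gcongr
          _ = _ := by field_simp

lemma threeP (d : ℕ) (hd : 2 ≤ d) (β lam : ℝ) (hβ : 0 < β) (hlam : 0 < lam) :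
    ∃ K : ℝ, 0 < K ∧ ∀ u s a b : ℝ, 0 < u → 0 < s → 0 ≤ a → 0 ≤ b →
      PP d β lam u a * PP d β (2 * lam / 3) s b ≤ K * PP d β (2 * lam / 3) (u + s) (a + b) *
        (PP d β (lam / 3) u a + PP d β (lam / 3) s b) := by
  obtain ⟨K1, hK1, h1⟩ := threeP_gh d hd β lam hβ hlam
  obtain ⟨K2, hK2, h2⟩ := threeP_hg d hd β lam hβ hlam
  have q1 : (0 : ℝ) < 4 ^ ((d : ℝ) / 2) := by positivity
  have q2 : (0 : ℝ) < 2 ^ β := by positivity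
  refine ⟨4 ^ ((d : ℝ) / 2) + 2 ^ β + K1 + K2, by positivity, fun u s a b hu hs ha hb => ?_⟩
  have ht : 0 < u + s := by linarith
  have hr : 0 ≤ a + b := by linarith
  have i1 := threeP_gg d (a := a) (b := b) hlam hu hs
  have i2 := threeP_hh hβ hu hs ha hb
  have i3 := h1 u s a b hu hs ha hb
  have i4 := h2 u s a b hu hs ha hb
  have j1 : gg d lam u a ≤ gg d (lam / 3) u a := gg_anti hu (by linarith) (by linarith) ha le_rfl
  have n1 := gg_nonneg (d := d) (c := lam / 3) (r := a) hu
  have n2 := gg_nonneg (d := d) (c := lam / 3) (r := b) hs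
  have n3 := gg_nonneg (d := d) (c := 2 * lam / 3) (r := a + b) ht
  have n4 := (hh_pos (β := β) hu ha).le
  have n5 := (hh_pos (β := β) hs hb).le
  have n6 := (hh_pos (β := β) ht hr).le
  unfold PP
  generalize gg d (lam / 3) u a = A1 at *
  generalize gg d (lam / 3) s b = A2 at *
  generalize gg d (2 * lam / 3) (u + s) (a + b) = T1 at *
  generalize hh β u a = B1 at *
  generalize hh β s b = B2 at *
  generalize hh β (u + s) (a + b) = T2 at *
  generalize gg d lam u a = X1 at *
  generalize gg d (2 * lam / 3) s b = X2 at *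
  generalize (4 : ℝ) ^ ((d : ℝ) / 2) = k1 at *
  generalize (2 : ℝ) ^ β = k2 at *
  have i3' : X1 * B2 ≤ K1 * ((T1 + T2) * (A1 + B1 + (A2 + B2))) := by
    refine i3.trans (mul_le_mul_of_nonneg_left ?_ hK1.le)
    nlinarith [mul_nonneg n3 n1, mul_nonneg n3 n2, mul_nonneg n3 n4, mul_nonneg n6 n2, mul_nonneg n6 n4, mul_nonneg n6 n5, mul_le_mul_of_nonneg_left j1 n6]
  have i4' : B1 * X2 ≤ K2 * ((T1 + T2) * (A1 + B1 + (A2 + B2))) := by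
    refine i4.trans (mul_le_mul_of_nonneg_left ?_ hK2.le)
    nlinarith [mul_nonneg n3 n1, mul_nonneg n3 n2, mul_nonneg n3 n5, mul_nonneg n6 n1, mul_nonneg n6 n4, mul_nonneg n6 n5]
  have i1' : X1 * X2 ≤ k1 * ((T1 + T2) * (A1 + B1 + (A2 + B2))) := by
    refine i1.trans ?_
    rw [mul_assoc]
    gcongr <;> linarith
  have i2' : B1 * B2 ≤ k2 * ((T1 + T2) * (A1 + B1 + (A2 + B2))) := by
    refine i2.trans ?_
    rw [mul_assoc]
    gcongr <;> linarith
  nlinarith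


lemma PP_comp {d : ℕ} {β c t r ρ : ℝ} (hβ : 0 < β) (hc : 0 < c) (ht : 0 < t) (hr : 0 ≤ r) (hρ : 0 ≤ ρ)
    (h : r ^ 2 ≤ ρ ^ 2 + 2 * t) :
    PP d β c t ρ ≤ (Real.exp (2 * c) + 3 ^ β) * PP d β c t r := by
  have h1 : gg d c t ρ ≤ Real.exp (2 * c) * gg d c t r := by
    unfold gg
    rw [mul_left_comm, ← Real.exp_add]
    gcongr
    have e1 : r ^ 2 / t ≤ ρ ^ 2 / t + 2 := by
      rw [div_le_iff₀ ht, add_mul, div_mul_cancel₀ _ ht.ne']; exact h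
    have := mul_le_mul_of_nonneg_left e1 hc.le
    simp only [neg_mul, neg_div, mul_div_assoc] at *
    linarith
  have h2 : hh β t ρ ≤ 3 ^ β * hh β t r := by
    apply hh_comp hβ ht le_rfl hρ hr (by norm_num)
    simp only [← Real.sqrt_eq_rpow]
    have h3 := Real.sqrt_nonneg t
    have h4 : r ≤ ρ + 2 * √t := by
      apply le_of_sq_le_sq _ (by positivity)
      nlinarith [Real.sq_sqrt ht.le, mul_nonneg hρ h3]
    linarith
  have n1 := gg_nonneg (d := d) (c := c) (r := r) ht
  have n2 := (hh_pos (β := β) ht hr).le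
  have n3 := Real.exp_pos (2 * c)
  have n4 : (0 : ℝ) < 3 ^ β := by positivity
  unfold PP
  nlinarith [mul_nonneg n3.le n2, mul_nonneg n4.le n1]

lemma near_pt (d : ℕ) (hd : 2 ≤ d) (β lam : ℝ) (hβ : 0 < β) (hlam : 0 < lam) :
    ∃ K : ℝ, 0 < K ∧ ∀ u s a b r : ℝ, 0 < u → 0 < s → 0 ≤ a → 0 ≤ b → 0 ≤ r →
      r ^ 2 ≤ (a + b) ^ 2 + 2 * (u + s) →
      PP d β lam u a * PP d β (2 * lam / 3) s b ≤ K * PP d β (2 * lam / 3) (u + s) r *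
        (PP d β (lam / 3) u a + PP d β (lam / 3) s b) := by
  obtain ⟨K, hK, h⟩ := threeP d hd β lam hβ hlam
  refine ⟨K * (Real.exp (2 * (2 * lam / 3)) + 3 ^ β), by positivity, fun u s a b r hu hs ha hb hr hle => ?_⟩
  have n1 := (PP_pos (d := d) (β := β) (c := lam / 3) hu ha).le
  have n2 := (PP_pos (d := d) (β := β) (c := lam / 3) hs hb).le
  have h2 := PP_comp (d := d) hβ (show 0 < 2 * lam / 3 by linarith) (add_pos hu hs) hr (add_nonneg ha hb) hle
  refine (h u s a b hu hs ha hb).trans ?_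
  calc _ ≤ K * ((Real.exp (2 * (2 * lam / 3)) + 3 ^ β) * PP d β (2 * lam / 3) (u + s) r) *
        (PP d β (lam / 3) u a + PP d β (lam / 3) s b) := by gcongr
    _ = _ := by ring

lemma gg_split {d : ℕ} {c c' e t u a r : ℝ} (hu : 0 < u) (hut : u ≤ t) (he : 0 ≤ e)
    (h : e * r ^ 2 ≤ (c' - c) * a ^ 2) :
    gg d c' u a ≤ Real.exp (-e * (r ^ 2 / t)) * gg d c u a := by
  unfold gg
  rw [mul_left_comm, ← Real.exp_add]
  gcongr
  have e1 : r ^ 2 / t ≤ r ^ 2 / u := by gcongr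
  have e2 : e * (r ^ 2 / u) ≤ (c' - c) * (a ^ 2 / u) := by
    rw [mul_div_assoc', mul_div_assoc']; gcongr
  have := mul_le_mul_of_nonneg_left e1 he
  simp only [neg_mul, neg_div, mul_div_assoc] at *
  linarith

lemma far_aux {t ρ r j : ℝ} (ht : 0 < t) (_hρ : 0 ≤ ρ) (hr : 0 ≤ r) (hle : r ≤ ρ + j)
    (h : ρ ^ 2 + 2 * t < r ^ 2) : 0 < r ∧ t ≤ r ^ 2 ∧ t ≤ j * r := by
  have h1 : ρ ≤ r := by
    apply le_of_sq_le_sq _ hr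
    linarith
  refine ⟨?_, by nlinarith [sq_nonneg ρ], by nlinarith⟩
  rcases hr.lt_or_eq with h' | h'
  · exact h'
  · rw [← h'] at h; nlinarith [sq_nonneg ρ]

set_option maxHeartbeats 1600000 in
lemma step_pt (d : ℕ) (hd : 2 ≤ d) (β lam B : ℝ) (hβ : 0 < β) (hlam : 0 < lam) (hB : 0 ≤ B) :
    ∃ K : ℝ, 0 < K ∧ ∀ u s a b r j Q A G δ : ℝ, 0 < u → 0 < s → 0 ≤ a → 0 ≤ b → 0 ≤ r → 0 ≤ j →
      r ≤ a + b + j → 0 ≤ Q → 0 ≤ A → Q ≤ A * PP d β (2 * lam / 3) s b → 0 ≤ G → G ≤ B →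
      0 < δ → δ ≤ 1 →
      PP d β lam u a * Q * (G / j ^ β) ≤
        K * A * PP d β (2 * lam / 3) (u + s) r *
          (PP d β (lam / 3) u a + PP d β (lam / 3) s b) * (G / j ^ β) +
        K * (hh β (u + s) r / (u + s)) * PP d β (lam / 3) u a *
          (δ * A * gg d (lam / 3) s b + δ⁻¹ * Q) := by
  obtain ⟨K1, hK1, h1⟩ := near_pt d hd β lam hβ hlam
  obtain ⟨K2, hK2, h2⟩ := exp_absorb β (lam / 54) hβ (by linarith)
  have q3 : (0 : ℝ) < 6 ^ β := by positivity
  obtain ⟨K, hKdef⟩ : ∃ K, K = K1 + B * 6 ^ β + 6 ^ β + B * K2 := ⟨_, rfl⟩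
  have m1 : 0 ≤ B * 6 ^ β := by positivity
  have m2 : 0 ≤ B * K2 := by positivity
  have hK : 0 < K := by rw [hKdef]; positivity
  refine ⟨K, hK, fun u s a b r j Q A G δ hu hs ha hb hr hj hle hQ hA hQA hG hGB hδ hδ1 => ?_⟩
  have ht : 0 < u + s := by linarith
  have n1 := (PP_pos (d := d) (β := β) (c := lam / 3) hu ha).le
  have n2 := (PP_pos (d := d) (β := β) (c := lam / 3) hs hb).le
  have n3 := (PP_pos (d := d) (β := β) (c := 2 * lam / 3) ht hr).le
  have n4 := (PP_pos (d := d) (β := β) (c := lam) hu ha).le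
  have n5 : 0 ≤ G / j ^ β := by positivity
  have n6 := (hh_pos (β := β) ht hr).le
  have n7 := gg_nonneg (d := d) (c := lam / 3) (r := b) hs
  have hδi : 1 ≤ δ⁻¹ := (one_le_inv₀ hδ).mpr hδ1
  have n8 : 0 ≤ δ * A * gg d (lam / 3) s b := by positivity
  have n9 : 0 ≤ δ⁻¹ * Q := by positivity
  have n10 : 0 ≤ hh β (u + s) r / (u + s) := by positivity
  have hhP : hh β (u + s) r ≤ PP d β (2 * lam / 3) (u + s) r := by
    unfold PP; linarith [gg_nonneg (d := d) (c := 2 * lam / 3) (r := r) ht]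
  have pmono : PP d β lam u a ≤ PP d β (lam / 3) u a := by
    unfold PP; linarith [gg_anti (d := d) (r := a) (r' := a) hu (show 0 ≤ lam / 3 by linarith) (show lam / 3 ≤ lam by linarith) ha le_rfl]
  have pmono2 : PP d β (2 * lam / 3) s b ≤ PP d β (lam / 3) s b := by
    unfold PP; linarith [gg_anti (d := d) (r := b) (r' := b) hs (show 0 ≤ lam / 3 by linarith) (show lam / 3 ≤ 2 * lam / 3 by linarith) hb le_rfl]
  have N0 : 0 ≤ A * PP d β (2 * lam / 3) (u + s) r *
          (PP d β (lam / 3) u a + PP d β (lam / 3) s b) * (G / j ^ β) := by positivity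
  have F0 : 0 ≤ (hh β (u + s) r / (u + s)) * PP d β (lam / 3) u a *
          (δ * A * gg d (lam / 3) s b + δ⁻¹ * Q) := by positivity
  obtain ⟨N, hN⟩ : ∃ N, N = A * PP d β (2 * lam / 3) (u + s) r *
          (PP d β (lam / 3) u a + PP d β (lam / 3) s b) * (G / j ^ β) := ⟨_, rfl⟩
  obtain ⟨F, hF⟩ : ∃ F, F = (hh β (u + s) r / (u + s)) * PP d β (lam / 3) u a *
          (δ * A * gg d (lam / 3) s b + δ⁻¹ * Q) := ⟨_, rfl⟩
  suffices hsuf : PP d β lam u a * Q * (G / j ^ β) ≤ K * N + K * F by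
    refine hsuf.trans (le_of_eq ?_)
    rw [hN, hF]; ring
  rw [← hN] at N0
  rw [← hF] at F0
  by_cases hnear : r ^ 2 ≤ (a + b) ^ 2 + 2 * (u + s)
  · have := h1 u s a b r hu hs ha hb hr hnear
    have e : PP d β lam u a * Q * (G / j ^ β) ≤ K1 * N := by
      calc _ ≤ PP d β lam u a * (A * PP d β (2 * lam / 3) s b) * (G / j ^ β) := by gcongr
        _ = A * (PP d β lam u a * PP d β (2 * lam / 3) s b) * (G / j ^ β) := by ring
        _ ≤ A * (K1 * PP d β (2 * lam / 3) (u + s) r *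
          (PP d β (lam / 3) u a + PP d β (lam / 3) s b)) * (G / j ^ β) := by gcongr
        _ = _ := by rw [hN]; ring
    have : K1 * N ≤ K * N := by gcongr; rw [hKdef]; linarith
    have : 0 ≤ K * F := by positivity
    linarith
  · push Not at hnear
    obtain ⟨hr0, htr, hjr⟩ := far_aux ht (add_nonneg ha hb) hr hle hnear
    have hj0 : 0 < j := by
      by_contra hcon
      have : j = 0 := le_antisymm (not_lt.mp hcon) hj
      rw [this] at hjr; linarith
    have hsq := sqrt_le hr htr
    have hJ : G / j ^ β ≤ B * (r / (u + s)) ^ β := by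
      rw [Real.div_rpow hr ht.le, mul_div_assoc', div_le_div_iff₀ (by positivity) (by positivity)]
      have : (u + s) ^ β ≤ r ^ β * j ^ β := by
        rw [← Real.mul_rpow hr hj]
        exact Real.rpow_le_rpow ht.le (by linarith) hβ.le
      calc G * (u + s) ^ β ≤ B * (r ^ β * j ^ β) := by gcongr
        _ = _ := by ring
    have hJe : (G / j ^ β) * Real.exp (-(lam / 54) * (r ^ 2 / (u + s))) ≤
        B * K2 * (hh β (u + s) r / (u + s)) := by
      calc _ ≤ B * (r / (u + s)) ^ β * Real.exp (-(lam / 54) * (r ^ 2 / (u + s))) := by gcongr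
        _ = B * ((r / (u + s)) ^ β * Real.exp (-(lam / 54) * (r ^ 2 / (u + s)))) := by ring
        _ ≤ B * (K2 * (hh β (u + s) r / (u + s))) := by
          exact mul_le_mul_of_nonneg_left (h2 _ _ ht hr0 htr) hB
        _ = _ := by ring
    have hQF : (hh β (u + s) r / (u + s)) * PP d β (lam / 3) u a * Q ≤ F := by
      rw [hF]; gcongr
      have := mul_le_mul_of_nonneg_right hδi hQ
      linarith
    have hcases : r ≤ 3 * j ∨ r ≤ 3 * a ∨ r ≤ 3 * b := by
      by_contra hcon
      push Not at hcon
      linarith [hcon.1, hcon.2.1, hcon.2.2]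
    rcases hcases with h3 | h3 | h3
    · have hJ2 : G / j ^ β ≤ B * 6 ^ β * (hh β (u + s) r / (u + s)) := by
        rw [hh_div ht, ← div_eq_mul_inv, div_le_div_iff₀ (by positivity) (by positivity)]
        have : ((u + s) ^ ((1 : ℝ) / 2) + r) ^ β ≤ 6 ^ β * j ^ β := by
          rw [← Real.mul_rpow (by norm_num) hj]
          exact Real.rpow_le_rpow (by positivity) (by linarith) hβ.le
        calc _ ≤ B * (6 ^ β * j ^ β) := by gcongr
          _ = _ := by ring
      have e : PP d β lam u a * Q * (G / j ^ β) ≤ B * 6 ^ β * F := by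
        calc _ ≤ PP d β (lam / 3) u a * Q * (B * 6 ^ β * (hh β (u + s) r / (u + s))) := by gcongr
          _ = B * 6 ^ β * ((hh β (u + s) r / (u + s)) * PP d β (lam / 3) u a * Q) := by ring
          _ ≤ _ := by gcongr
      have : B * 6 ^ β * F ≤ K * F := by gcongr; rw [hKdef]; linarith
      have : 0 ≤ K * N := by positivity
      linarith
    · have hha : hh β u a ≤ 6 ^ β * hh β (u + s) r :=
        hh_large hβ hu (by linarith) ha hr (by norm_num) htr (by linarith)
      have hga : gg d lam u a ≤ Real.exp (-(lam / 54) * (r ^ 2 / (u + s))) * gg d (lam / 3) u a := by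
        apply gg_split hu (by linarith) (by linarith)
        have : r ^ 2 ≤ 9 * a ^ 2 := by nlinarith only [h3, hr, ha]
        nlinarith only [mul_le_mul_of_nonneg_left this hlam.le, mul_nonneg hlam.le (sq_nonneg a)]
      have hgP : gg d (lam / 3) u a ≤ PP d β (lam / 3) u a := by
        unfold PP; linarith [hh_pos (β := β) hu ha]
      have ng := gg_nonneg (d := d) (c := lam / 3) (r := a) hu
      have nh := (hh_pos (β := β) hu ha).le
      have e1 : hh β u a * Q * (G / j ^ β) ≤ 6 ^ β * N := by
        calc _ ≤ (6 ^ β * PP d β (2 * lam / 3) (u + s) r) * (A * PP d β (lam / 3) s b) * (G / j ^ β) := by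
              gcongr
              · exact hha.trans (by gcongr)
              · exact hQA.trans (by gcongr)
          _ = 6 ^ β * (A * PP d β (2 * lam / 3) (u + s) r * (PP d β (lam / 3) s b) * (G / j ^ β)) := by ring
          _ ≤ _ := by
            rw [hN]; gcongr
            linarith
      have e2 : gg d lam u a * Q * (G / j ^ β) ≤ B * K2 * F := by
        calc _ ≤ (Real.exp (-(lam / 54) * (r ^ 2 / (u + s))) * PP d β (lam / 3) u a) * Q * (G / j ^ β) := by
              gcongr
              exact hga.trans (by gcongr)
          _ = ((G / j ^ β) * Real.exp (-(lam / 54) * (r ^ 2 / (u + s)))) * (PP d β (lam / 3) u a * Q) := by ring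
          _ ≤ (B * K2 * (hh β (u + s) r / (u + s))) * (PP d β (lam / 3) u a * Q) := by gcongr
          _ = B * K2 * ((hh β (u + s) r / (u + s)) * PP d β (lam / 3) u a * Q) := by ring
          _ ≤ _ := by gcongr
      have : B * K2 * F ≤ K * F := by gcongr; rw [hKdef]; linarith
      have : 6 ^ β * N ≤ K * N := by gcongr; rw [hKdef]; linarith
      have : PP d β lam u a * Q * (G / j ^ β) = gg d lam u a * Q * (G / j ^ β) + hh β u a * Q * (G / j ^ β) := by
        unfold PP; ring
      linarith
    · have hhb : hh β s b ≤ 6 ^ β * hh β (u + s) r :=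
        hh_large hβ hs (by linarith) hb hr (by norm_num) htr (by linarith)
      have hgb : gg d (2 * lam / 3) s b ≤ Real.exp (-(lam / 27) * (r ^ 2 / (u + s))) * gg d (lam / 3) s b := by
        apply gg_split hs (by linarith) (by linarith)
        have : r ^ 2 ≤ 9 * b ^ 2 := by nlinarith only [h3, hr, hb]
        nlinarith only [mul_le_mul_of_nonneg_left this hlam.le, mul_nonneg hlam.le (sq_nonneg b)]
      have ng := gg_nonneg (d := d) (c := 2 * lam / 3) (r := b) hs
      have nh := (hh_pos (β := β) hs hb).le
      obtain ⟨E, hE⟩ : ∃ E, E = Real.exp (-(lam / 54) * (r ^ 2 / (u + s))) := ⟨_, rfl⟩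
      have hE0 : 0 < E := by rw [hE]; positivity
      have hE2 : Real.exp (-(lam / 27) * (r ^ 2 / (u + s))) = E * E := by
        rw [hE, ← Real.exp_add]; congr 1; ring
      rw [hE2] at hgb
      rw [← hE] at hJe
      have hQ1 : Q ≤ E * (δ * A * gg d (lam / 3) s b + δ⁻¹ * Q) + A * hh β s b := by
        rcases le_total (E * δ⁻¹) 1 with hc | hc
        · have e1 : E ≤ δ := by
            rw [← div_eq_mul_inv, div_le_one hδ] at hc; exact hc
          have e2 : A * gg d (2 * lam / 3) s b ≤ E * (δ * A * gg d (lam / 3) s b) := by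
            calc _ ≤ A * (E * E * gg d (lam / 3) s b) := by gcongr
              _ ≤ A * (E * δ * gg d (lam / 3) s b) := by gcongr
              _ = _ := by ring
          have e3 : 0 ≤ E * (δ⁻¹ * Q) := by positivity
          unfold PP at hQA
          rw [mul_add] at hQA ⊢
          linarith
        · have e1 : Q ≤ E * (δ⁻¹ * Q) := by nlinarith only [hc, hQ]
          have e2 : 0 ≤ E * (δ * A * gg d (lam / 3) s b) := by positivity
          have e3 : 0 ≤ A * hh β s b := by positivity
          rw [mul_add]; linarith
      have e1 : PP d β lam u a * (A * hh β s b) * (G / j ^ β) ≤ 6 ^ β * N := by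
        calc _ ≤ PP d β (lam / 3) u a * (A * (6 ^ β * PP d β (2 * lam / 3) (u + s) r)) * (G / j ^ β) := by
              gcongr
              exact hhb.trans (by gcongr)
          _ = 6 ^ β * (A * PP d β (2 * lam / 3) (u + s) r * (PP d β (lam / 3) u a) * (G / j ^ β)) := by ring
          _ ≤ _ := by
            rw [hN]; gcongr
            linarith
      have e2 : PP d β lam u a * (E * (δ * A * gg d (lam / 3) s b + δ⁻¹ * Q)) * (G / j ^ β) ≤ B * K2 * F := by
        calc _ ≤ PP d β (lam / 3) u a * (E * (δ * A * gg d (lam / 3) s b + δ⁻¹ * Q)) * (G / j ^ β) := by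
              gcongr
          _ = ((G / j ^ β) * E) * (PP d β (lam / 3) u a * (δ * A * gg d (lam / 3) s b + δ⁻¹ * Q)) := by ring
          _ ≤ (B * K2 * (hh β (u + s) r / (u + s))) * (PP d β (lam / 3) u a * (δ * A * gg d (lam / 3) s b + δ⁻¹ * Q)) := by gcongr
          _ = _ := by rw [hF]; ring
      have : B * K2 * F ≤ K * F := by gcongr; rw [hKdef]; linarith
      have : 6 ^ β * N ≤ K * N := by gcongr; rw [hKdef]; linarith
      calc _ ≤ PP d β lam u a * (E * (δ * A * gg d (lam / 3) s b + δ⁻¹ * Q) + A * hh β s b) * (G / j ^ β) := by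
            gcongr
        _ = PP d β lam u a * (E * (δ * A * gg d (lam / 3) s b + δ⁻¹ * Q)) * (G / j ^ β) +
            PP d β lam u a * (A * hh β s b) * (G / j ^ β) := by ring
        _ ≤ _ := by linarith


lemma meas_PP {X : Type*} [MeasurableSpace X] {E : Type*} [NormedAddCommGroup E] [MeasurableSpace E]
    [OpensMeasurableSpace E] (d : ℕ) (β c : ℝ) {f : X → ℝ} {g : X → E}
    (hf : Measurable f) (hg : Measurable g) :
    Measurable (fun p => ENNReal.ofReal (PP d β c (f p) ‖g p‖)) := by
  unfold PP gg hh
  fun_prop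

lemma PP_bound (d : ℕ) (α c : ℝ) (hα : 0 < α) (hα2 : α < 2) (hc : 0 < c) :
    ∃ K : ℝ, 0 < K ∧ ∀ u r : ℝ, 0 < u → u ≤ 1 → 0 ≤ r →
      PP d ((d : ℝ) + α) c u r ≤
        K * (u ^ (-(d : ℝ) / 2) * (1 + u ^ (-(1 : ℝ) / 2) * r) ^ (-((d : ℝ) + α))) := by
  have hβ : 0 < (d : ℝ) + α := by positivity
  obtain ⟨K, hK, h⟩ := exp_poly ((d : ℝ) + α) c hβ hc
  refine ⟨2 ^ ((d : ℝ) + α) * K * Real.exp c + 1, by positivity, fun u r hu hu1 hr => ?_⟩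
  have hsu : 0 < u ^ (-(1 : ℝ) / 2) := by positivity
  obtain ⟨ρ, hρ⟩ : ∃ ρ, ρ = u ^ (-(1 : ℝ) / 2) * r := ⟨_, rfl⟩
  have hρ0 : 0 ≤ ρ := by rw [hρ]; positivity
  have hρ2 : ρ ^ 2 = r ^ 2 / u := by
    rw [hρ, mul_pow, ← Real.rpow_natCast, ← Real.rpow_mul hu.le]
    norm_num
    rw [Real.rpow_neg_one]; field_simp
  rw [← hρ]
  have hg : Real.exp (-c * r ^ 2 / u) ≤
      (2 ^ ((d : ℝ) + α) * K * Real.exp c) * (1 + ρ) ^ (-((d : ℝ) + α)) := by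
    rw [mul_div_assoc, ← hρ2, Real.rpow_neg (by positivity), ← div_eq_mul_inv, le_div_iff₀ (by positivity)]
    have e1 : (1 + ρ) ^ ((d : ℝ) + α) ≤ 2 ^ ((d : ℝ) + α) * (1 + ρ ^ 2) ^ ((d : ℝ) + α) := by
      rw [← Real.mul_rpow (by norm_num) (by positivity)]
      apply Real.rpow_le_rpow (by positivity) _ hβ.le
      nlinarith [sq_nonneg (ρ - 1)]
    have e2 := h (1 + ρ ^ 2) (by positivity)
    have e3 : Real.exp (-c * ρ ^ 2) = Real.exp (-c * (1 + ρ ^ 2)) * Real.exp c := by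
      rw [← Real.exp_add]; congr 1; ring
    rw [e3]
    calc _ ≤ Real.exp (-c * (1 + ρ ^ 2)) * Real.exp c * (2 ^ ((d : ℝ) + α) * (1 + ρ ^ 2) ^ ((d : ℝ) + α)) := by
          gcongr
      _ = 2 ^ ((d : ℝ) + α) * ((1 + ρ ^ 2) ^ ((d : ℝ) + α) * Real.exp (-c * (1 + ρ ^ 2))) * Real.exp c := by
          ring
      _ ≤ _ := by gcongr
  have hh1 : hh ((d : ℝ) + α) u r ≤ u ^ (-(d : ℝ) / 2) * (1 + ρ) ^ (-((d : ℝ) + α)) := by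
    have e1 : u ^ ((1 : ℝ) / 2) + r = u ^ ((1 : ℝ) / 2) * (1 + ρ) := by
      rw [hρ, mul_add, mul_one, ← mul_assoc, ← Real.rpow_add hu]; norm_num
    unfold hh
    rw [e1, Real.mul_rpow (by positivity) (by positivity), ← Real.rpow_mul hu.le,
      Real.rpow_neg (by positivity), ← div_eq_mul_inv, ← div_div]
    gcongr
    rw [div_le_iff₀ (by positivity), ← Real.rpow_add hu]
    conv_lhs => rw [← Real.rpow_one u]
    apply Real.rpow_le_rpow_of_exponent_ge hu hu1
    linarith
  unfold PP gg
  calc _ ≤ u ^ (-(d : ℝ) / 2) * ((2 ^ ((d : ℝ) + α) * K * Real.exp c) * (1 + ρ) ^ (-((d : ℝ) + α))) +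
      u ^ (-(d : ℝ) / 2) * (1 + ρ) ^ (-((d : ℝ) + α)) := by gcongr
    _ = _ := by ring

lemma lint_PP (d : ℕ) (α c : ℝ) (hα : 0 < α) (hα2 : α < 2) (hc : 0 < c) :
    ∃ K : ℝ, 0 < K ∧ ∀ u : ℝ, 0 < u → u ≤ 1 → ∀ x : EuclideanSpace ℝ (Fin d),
      ∫⁻ z, ENNReal.ofReal (PP d ((d : ℝ) + α) c u ‖x - z‖) ≤ ENNReal.ofReal K := by
  obtain ⟨K, hK, h⟩ := PP_bound d α c hα hα2 hc
  have hfin : (∫⁻ x : EuclideanSpace ℝ (Fin d), ENNReal.ofReal ((1 + ‖x‖) ^ (-((d : ℝ) + α)))) < ∞ := by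
    apply finite_integral_one_add_norm
    simp; exact hα
  obtain ⟨I, hI⟩ : ∃ I, I = ∫⁻ x : EuclideanSpace ℝ (Fin d), ENNReal.ofReal ((1 + ‖x‖) ^ (-((d : ℝ) + α))) := ⟨_, rfl⟩
  rw [← hI] at hfin
  refine ⟨K * (I.toReal + 1), by positivity, fun u hu hu1 x => ?_⟩
  rw [lintegral_sub_left_eq_self (fun z => ENNReal.ofReal (PP d ((d : ℝ) + α) c u ‖z‖)) x]
  have hsu : 0 < u ^ (-(1 : ℝ) / 2) := by positivity
  have hm : Measurable (fun z : EuclideanSpace ℝ (Fin d) => ENNReal.ofReal ((1 + ‖z‖) ^ (-((d : ℝ) + α)))) := by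
    fun_prop
  have hscale : ∫⁻ z : EuclideanSpace ℝ (Fin d), ENNReal.ofReal ((1 + ‖(u ^ (-(1 : ℝ) / 2)) • z‖) ^ (-((d : ℝ) + α)))
      = ENNReal.ofReal (u ^ ((d : ℝ) / 2)) * I := by
    rw [← lintegral_map hm (measurable_const_smul _), Measure.map_addHaar_smul _ hsu.ne',
      lintegral_smul_measure, ← hI, smul_eq_mul]
    congr 2
    rw [abs_of_pos (by positivity), finrank_euclideanSpace_fin, ← Real.rpow_natCast, ← Real.rpow_mul hu.le,
      ← Real.rpow_neg hu.le]
    congr 1; ring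
  calc _ ≤ ∫⁻ z : EuclideanSpace ℝ (Fin d), ENNReal.ofReal (K * u ^ (-(d : ℝ) / 2)) *
        ENNReal.ofReal ((1 + ‖(u ^ (-(1 : ℝ) / 2)) • z‖) ^ (-((d : ℝ) + α))) := by
        apply lintegral_mono
        intro z
        dsimp only
        rw [← ENNReal.ofReal_mul (by positivity)]
        apply ENNReal.ofReal_le_ofReal
        refine (h u ‖z‖ hu hu1 (norm_nonneg z)).trans (le_of_eq ?_)
        rw [norm_smul, Real.norm_of_nonneg hsu.le]; ring
    _ = ENNReal.ofReal (K * u ^ (-(d : ℝ) / 2)) * (ENNReal.ofReal (u ^ ((d : ℝ) / 2)) * I) := by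
        rw [lintegral_const_mul' _ _ ENNReal.ofReal_ne_top, hscale]
    _ = ENNReal.ofReal K * I := by
        rw [← mul_assoc, ← ENNReal.ofReal_mul (by positivity), mul_assoc, ← Real.rpow_add hu]
        congr 2
        rw [show -(d : ℝ) / 2 + (d : ℝ) / 2 = 0 by ring]; simp
    _ ≤ _ := by
        rw [ENNReal.ofReal_mul hK.le]
        gcongr
        rw [← ENNReal.ofReal_toReal hfin.ne]
        simp
        gcongr; linarith

lemma time_refl (t : ℝ) (f : ℝ → ℝ≥0∞) :
    ∫⁻ s in Ioo 0 t, f (t - s) = ∫⁻ s in Ioo 0 t, f s := by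
  rw [← lintegral_indicator measurableSet_Ioo, ← lintegral_indicator measurableSet_Ioo,
    ← lintegral_sub_left_eq_self (fun s => (Ioo 0 t).indicator f s) t]
  congr 1
  ext s
  by_cases hs : s ∈ Ioo 0 t
  · have : t - s ∈ Ioo 0 t := ⟨by linarith [hs.2], by linarith [hs.1]⟩
    rw [indicator_of_mem hs, indicator_of_mem this]
  · have : t - s ∉ Ioo 0 t := fun h => hs ⟨by linarith [h.2], by linarith [h.1]⟩
    rw [indicator_of_notMem hs, indicator_of_notMem this]

lemma mass_gen {E Z : Type*} [MeasurableSpace E] [MeasurableSpace Z] (vol : Measure E) [SFinite vol]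
    (ν : Measure Z) [SFinite ν]
    (t : ℝ) (k : E → ℝ → Z → ℝ≥0∞) (hk : Measurable (fun p : E × ℝ × Z => k p.1 p.2.1 p.2.2))
    (l : ℝ → Z → ℝ≥0∞) (hl : Measurable (fun p : ℝ × Z => l p.1 p.2)) (K : ℝ≥0∞) (hK : K ≠ ∞)
    (h : ∀ s ∈ Ioo 0 t, ∀ z, ∫⁻ x, k x s z ∂vol ≤ K) :
    ∫⁻ x, (∫⁻ s in Ioo 0 t, (∫⁻ z, k x s z * l s z ∂ν)) ∂vol ≤ K * ∫⁻ s in Ioo 0 t, ∫⁻ z, l s z ∂ν := by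
  have hm : Measurable (fun p : E × ℝ × Z => k p.1 p.2.1 p.2.2 * l p.2.1 p.2.2) :=
    hk.mul (hl.comp measurable_snd)
  have hm2 : Measurable (fun p : E × ℝ => ∫⁻ z, k p.1 p.2 z * l p.2 z ∂ν) := by
    apply Measurable.lintegral_prod_right' (f := fun q : (E × ℝ) × Z => k q.1.1 q.1.2 q.2 * l q.1.2 q.2)
    exact hm.comp (show Measurable (fun q : (E × ℝ) × Z => (q.1.1, q.1.2, q.2)) by fun_prop)
  rw [lintegral_lintegral_swap hm2.aemeasurable, ← lintegral_const_mul' _ _ hK]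
  apply setLIntegral_mono' measurableSet_Ioo
  intro s hs
  have hms : Measurable (fun p : E × Z => k p.1 s p.2 * l s p.2) :=
    hm.comp (show Measurable (fun q : E × Z => (q.1, s, q.2)) by fun_prop)
  rw [lintegral_lintegral_swap hms.aemeasurable, ← lintegral_const_mul' _ _ hK]
  apply lintegral_mono
  intro z
  dsimp only
  have hmx : Measurable (fun x => k x s z) := hk.comp (show Measurable (fun x : E => (x, s, z)) by fun_prop)
  rw [lintegral_mul_const _ hmx]
  gcongr
  exact h s hs z

lemma Nmu_sfinite (d : ℕ) (α c : ℝ) (hα : 0 < α) (μ : Measure (EuclideanSpace ℝ (Fin d))) (t : ℝ)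
    (ht : 0 < t) (h : Nmu d α c μ t ≠ ∞) : SFinite μ := by
  have h1 : ∫⁻ s in Ioc (0 : ℝ) t, ∫⁻ y, ENNReal.ofReal (PP d ((d : ℝ) + α) c s ‖(0 : EuclideanSpace ℝ (Fin d)) - y‖) ∂μ ≠ ∞ :=
    ne_top_of_le_ne_top h (le_iSup (fun x : EuclideanSpace ℝ (Fin d) => ∫⁻ s in Set.Ioc (0 : ℝ) t, ∫⁻ y,
      ENNReal.ofReal (Gam d c s (x - y) + eta d α s (x - y)) ∂μ) 0)
  have h2 : ∃ s ∈ Ioc (0 : ℝ) t, ∫⁻ y, ENNReal.ofReal (PP d ((d : ℝ) + α) c s ‖(0 : EuclideanSpace ℝ (Fin d)) - y‖) ∂μ ≠ ∞ := by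
    by_contra hcon
    push Not at hcon
    apply h1
    rw [setLIntegral_congr_fun measurableSet_Ioc hcon]
    simp [ht]
  obtain ⟨s, hs, h3⟩ := h2
  have : IsFiniteMeasureOnCompacts μ := by
    constructor
    intro S hS
    obtain ⟨R, hR⟩ := hS.isBounded.exists_norm_le
    have hs0 := hs.1
    have key : ∀ y ∈ S, hh ((d : ℝ) + α) s (max R 0) ≤ PP d ((d : ℝ) + α) c s ‖(0 : EuclideanSpace ℝ (Fin d)) - y‖ := by
      intro y hy
      have e1 : ‖y‖ ≤ max R 0 := (hR y hy).trans (le_max_left _ _)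
      have e2 := gg_nonneg (d := d) (c := c) (r := ‖y‖) hs0
      have e3 : hh ((d : ℝ) + α) s (max R 0) ≤ hh ((d : ℝ) + α) s ‖y‖ := by
        unfold hh; gcongr
      simp only [zero_sub, norm_neg]
      unfold PP; linarith
    have pos := hh_pos (β := (d : ℝ) + α) hs0 (le_max_right R 0)
    by_contra hcon
    have htop : μ S = ∞ := by simpa using hcon
    apply h3
    rw [eq_top_iff]
    calc ∞ = ENNReal.ofReal (hh ((d : ℝ) + α) s (max R 0)) * μ S := by
          rw [htop, ENNReal.mul_top]; simpa using pos
      _ = ∫⁻ y in S, ENNReal.ofReal (hh ((d : ℝ) + α) s (max R 0)) ∂μ := by simp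
      _ ≤ ∫⁻ y in S, ENNReal.ofReal (PP d ((d : ℝ) + α) c s ‖(0 : EuclideanSpace ℝ (Fin d)) - y‖) ∂μ :=
          setLIntegral_mono' hS.measurableSet (fun y hy => ENNReal.ofReal_le_ofReal (key y hy))
      _ ≤ _ := setLIntegral_le_lintegral _ _
  infer_instance

lemma lint_add2 {Z : Type*} [MeasurableSpace Z] (ν : Measure Z) [SFinite ν] (t : ℝ)
    (f g : ℝ → Z → ℝ≥0∞) (hf : Measurable (fun p : ℝ × Z => f p.1 p.2)) :
    ∫⁻ s in Ioo 0 t, ∫⁻ z, (f s z + g s z) ∂ν =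
      (∫⁻ s in Ioo 0 t, ∫⁻ z, f s z ∂ν) + ∫⁻ s in Ioo 0 t, ∫⁻ z, g s z ∂ν := by
  rw [← lintegral_add_left (Measurable.lintegral_prod_right' (f := fun p : ℝ × Z => f p.1 p.2) hf)]
  congr 1
  ext s
  have hm : Measurable (fun z => f s z) := hf.comp (show Measurable (fun z : Z => (s, z)) by fun_prop)
  rw [lintegral_add_left hm]

lemma lint_const2 {Z : Type*} [MeasurableSpace Z] (ν : Measure Z) (t : ℝ)
    (f : ℝ → Z → ℝ≥0∞) (K : ℝ≥0∞) (hK : K ≠ ∞) :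
    ∫⁻ s in Ioo 0 t, ∫⁻ z, K * f s z ∂ν = K * ∫⁻ s in Ioo 0 t, ∫⁻ z, f s z ∂ν := by
  rw [← lintegral_const_mul' _ _ hK]
  congr 1
  ext s
  rw [lintegral_const_mul' _ _ hK]

lemma lint_mono2 {Z : Type*} [MeasurableSpace Z] (ν : Measure Z) (t : ℝ)
    (f g : ℝ → Z → ℝ≥0∞) (h : ∀ s ∈ Ioo 0 t, ∀ z, f s z ≤ g s z) :
    ∫⁻ s in Ioo 0 t, ∫⁻ z, f s z ∂ν ≤ ∫⁻ s in Ioo 0 t, ∫⁻ z, g s z ∂ν :=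
  setLIntegral_mono' measurableSet_Ioo (fun s hs => lintegral_mono (h s hs))

lemma muS (d : ℕ) (α c : ℝ) (μ : Measure (EuclideanSpace ℝ (Fin d))) (t t1 : ℝ) (h : t ≤ t1)
    (y : EuclideanSpace ℝ (Fin d)) :
    ∫⁻ s in Ioo 0 t, ∫⁻ z, ENNReal.ofReal (PP d ((d : ℝ) + α) c s ‖y - z‖) ∂μ ≤ Nmu d α c μ t1 := by
  refine le_trans ?_ (le_iSup (fun x : EuclideanSpace ℝ (Fin d) => ∫⁻ s in Set.Ioc (0 : ℝ) t1, ∫⁻ y,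
      ENNReal.ofReal (Gam d c s (x - y) + eta d α s (x - y)) ∂μ) y)
  exact lintegral_mono_set (fun s hs => ⟨hs.1, hs.2.le.trans h⟩)

lemma muU (d : ℕ) (α c : ℝ) (μ : Measure (EuclideanSpace ℝ (Fin d))) (t t1 : ℝ) (h : t ≤ t1)
    (y : EuclideanSpace ℝ (Fin d)) :
    ∫⁻ s in Ioo 0 t, ∫⁻ z, ENNReal.ofReal (PP d ((d : ℝ) + α) c (t - s) ‖y - z‖) ∂μ ≤ Nmu d α c μ t1 := by
  rw [time_refl t (fun s => ∫⁻ z, ENNReal.ofReal (PP d ((d : ℝ) + α) c s ‖y - z‖) ∂μ)]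
  exact muS d α c μ t t1 h y

lemma GV (d : ℕ) (α c : ℝ) (G : EuclideanSpace ℝ (Fin d) → EuclideanSpace ℝ (Fin d) → ℝ)
    (hG : ∀ z w, 0 ≤ G z w) (t t1 : ℝ) (h : t ≤ t1)
    (y : EuclideanSpace ℝ (Fin d)) :
    ∫⁻ s in Ioo 0 t, ∫⁻ zw : EuclideanSpace ℝ (Fin d) × EuclideanSpace ℝ (Fin d),
      ENNReal.ofReal (PP d ((d : ℝ) + α) c s ‖y - zw.1‖) *
        ENNReal.ofReal ((G zw.1 zw.2 + G zw.2 zw.1) / ‖zw.1 - zw.2‖ ^ ((d : ℝ) + α)) ≤ NF d α c G t1 := by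
  refine le_trans ?_ (le_iSup (fun y : EuclideanSpace ℝ (Fin d) => ∫⁻ s in Set.Ioc (0 : ℝ) t1,
    ∫⁻ zw : EuclideanSpace ℝ (Fin d) × EuclideanSpace ℝ (Fin d),
      ENNReal.ofReal ((Gam d c s (y - zw.1) + eta d α s (y - zw.1)) *
        (G zw.1 zw.2 + G zw.2 zw.1) / ‖zw.1 - zw.2‖ ^ ((d : ℝ) + α))) y)
  refine le_trans ?_ (lintegral_mono_set (show Ioo 0 t ⊆ Ioc 0 t1 from fun s hs => ⟨hs.1, hs.2.le.trans h⟩))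
  apply lint_mono2
  intro s hs zw
  rw [← ENNReal.ofReal_mul (PP_pos hs.1 (norm_nonneg _)).le]
  rw [mul_div_assoc]
  rfl

lemma GS (d : ℕ) (α c : ℝ) (G : EuclideanSpace ℝ (Fin d) → EuclideanSpace ℝ (Fin d) → ℝ)
    (hG : ∀ z w, 0 ≤ G z w) (t t1 : ℝ) (h : t ≤ t1)
    (y : EuclideanSpace ℝ (Fin d)) :
    ∫⁻ s in Ioo 0 t, ∫⁻ zw : EuclideanSpace ℝ (Fin d) × EuclideanSpace ℝ (Fin d),
      ENNReal.ofReal (PP d ((d : ℝ) + α) c s ‖y - zw.2‖) *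
        ENNReal.ofReal (G zw.1 zw.2 / ‖zw.1 - zw.2‖ ^ ((d : ℝ) + α)) ≤ NF d α c G t1 := by
  refine le_trans ?_ (GV d α c G hG t t1 h y)
  apply lintegral_mono
  intro s
  dsimp only
  conv_rhs => rw [Measure.volume_eq_prod, ← lintegral_prod_swap]
  apply lintegral_mono
  intro zw
  dsimp only [Prod.fst_swap, Prod.snd_swap]
  rw [norm_sub_rev zw.1 zw.2]
  gcongr
  simpa using hG _ _

lemma GU (d : ℕ) (α c : ℝ) (G : EuclideanSpace ℝ (Fin d) → EuclideanSpace ℝ (Fin d) → ℝ)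
    (hG : ∀ z w, 0 ≤ G z w) (t t1 : ℝ) (h : t ≤ t1)
    (y : EuclideanSpace ℝ (Fin d)) :
    ∫⁻ s in Ioo 0 t, ∫⁻ zw : EuclideanSpace ℝ (Fin d) × EuclideanSpace ℝ (Fin d),
      ENNReal.ofReal (PP d ((d : ℝ) + α) c (t - s) ‖y - zw.1‖) *
        ENNReal.ofReal (G zw.1 zw.2 / ‖zw.1 - zw.2‖ ^ ((d : ℝ) + α)) ≤ NF d α c G t1 := by
  rw [time_refl t (fun s => ∫⁻ zw : EuclideanSpace ℝ (Fin d) × EuclideanSpace ℝ (Fin d),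
      ENNReal.ofReal (PP d ((d : ℝ) + α) c s ‖y - zw.1‖) *
        ENNReal.ofReal (G zw.1 zw.2 / ‖zw.1 - zw.2‖ ^ ((d : ℝ) + α)))]
  refine le_trans ?_ (GV d α c G hG t t1 h y)
  apply lint_mono2
  intro s hs zw
  gcongr
  simpa using hG _ _

lemma far_bd {E : Type*} [MeasurableSpace E] (ν : Measure E) [SFinite ν] (t : ℝ) (f g : ℝ → E → ℝ≥0∞) (a b : ℝ≥0∞)
    (hf : ∀ s ∈ Ioo 0 t, ∫⁻ z, f s z ∂ν ≤ a) (hg : ∀ s ∈ Ioo 0 t, ∫⁻ z, g s z ∂ν ≤ b)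
    (hfm : ∀ s, Measurable (f s)) (hfin : ∀ s ∈ Ioo 0 t, ∀ z, f s z ≠ ∞) :
    ∫⁻ s in Ioo 0 t, ∫⁻ zw : E × E, f s zw.1 * g s zw.2 ∂(ν.prod ν) ≤ a * b * ENNReal.ofReal t := by
  calc _ ≤ ∫⁻ s in Ioo 0 t, a * b := by
        apply setLIntegral_mono' measurableSet_Ioo
        intro s hs
        refine (lintegral_prod_le _).trans ?_
        calc _ = ∫⁻ z, f s z * ∫⁻ w, g s w ∂ν ∂ν := by
              congr 1; ext z
              rw [lintegral_const_mul' _ _ (hfin s hs z)]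
          _ = (∫⁻ z, f s z ∂ν) * ∫⁻ w, g s w ∂ν := lintegral_mul_const _ (hfm s)
          _ ≤ a * b := by gcongr; exacts [hf s hs, hg s hs]
    _ = _ := by simp

lemma two_ofReal (a : ℝ) (N : ℝ≥0∞) : ENNReal.ofReal a * (N + N) = ENNReal.ofReal (2 * a) * N := by
  rw [ENNReal.ofReal_mul (by norm_num), ← two_mul]
  simp; ring

lemma near_int (d : ℕ) (hd : 2 ≤ d) (α : ℝ) (hα : 0 < α) (C lam : ℝ) (hC : 1 ≤ C) (hlam : 0 < lam) :
    ∃ K : ℝ, 0 < K ∧ ∀ (μ : Measure (EuclideanSpace ℝ (Fin d))) [SFinite μ] (t t1 : ℝ), 0 < t → t ≤ t1 → t1 ≤ 1 →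
      ∀ (x y : EuclideanSpace ℝ (Fin d)) (P : ℝ → EuclideanSpace ℝ (Fin d) → ℝ)
        (Q : ℝ → EuclideanSpace ℝ (Fin d) → ℝ≥0∞) (A : ℝ), 0 ≤ A →
        (∀ u ∈ Ioc (0 : ℝ) 1, ∀ z, P u z ≤ C * PP d ((d : ℝ) + α) lam u ‖x - z‖) →
        (∀ s ∈ Ioo (0 : ℝ) t, ∀ z, Q s z ≤ ENNReal.ofReal (A * PP d ((d : ℝ) + α) (2 * lam / 3) s ‖z - y‖)) →
        ∫⁻ s in Ioo 0 t, ∫⁻ z, ENNReal.ofReal (P (t - s) z) * Q s z ∂μ ≤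
          ENNReal.ofReal (K * A * PP d ((d : ℝ) + α) (2 * lam / 3) t ‖x - y‖) * Nmu d α (lam / 3) μ t1 := by
  have hβ : (d : ℝ) ≤ (d : ℝ) + α := by linarith
  obtain ⟨K, hK, h⟩ := near_pt d hd ((d : ℝ) + α) lam (by positivity) hlam
  refine ⟨2 * C * K, by positivity, ?_⟩
  intro μ _ t t1 ht htt ht1 x y P Q A hA hP hQ
  have hPt := PP_pos (d := d) (β := (d : ℝ) + α) (c := 2 * lam / 3) ht (norm_nonneg (x - y))
  calc _ ≤ ∫⁻ s in Ioo 0 t, ∫⁻ z, ENNReal.ofReal (C * A * K * PP d ((d : ℝ) + α) (2 * lam / 3) t ‖x - y‖) *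
        (ENNReal.ofReal (PP d ((d : ℝ) + α) (lam / 3) (t - s) ‖x - z‖) +
          ENNReal.ofReal (PP d ((d : ℝ) + α) (lam / 3) s ‖y - z‖)) ∂μ := by
        apply lint_mono2
        intro s hs z
        have hu : 0 < t - s := by linarith [hs.2]
        have e1 := PP_pos (d := d) (β := (d : ℝ) + α) (c := lam / 3) hu (norm_nonneg (x - z))
        have e2 := PP_pos (d := d) (β := (d : ℝ) + α) (c := lam / 3) hs.1 (norm_nonneg (y - z))
        have e3 := PP_pos (d := d) (β := (d : ℝ) + α) (c := lam) hu (norm_nonneg (x - z))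
        have hb := hP (t - s) ⟨hu, by linarith [hs.1]⟩ z
        have hr : ‖x - y‖ ≤ ‖x - z‖ + ‖z - y‖ := norm_sub_le_norm_sub_add_norm_sub x z y
        have hk := h (t - s) s ‖x - z‖ ‖z - y‖ ‖x - y‖ hu hs.1 (norm_nonneg _) (norm_nonneg _) (norm_nonneg _)
          (by have := norm_nonneg (x - y); nlinarith [hs.1])
        rw [sub_add_cancel] at hk
        rw [norm_sub_rev y z] at e2 ⊢
        calc _ ≤ ENNReal.ofReal (C * PP d ((d : ℝ) + α) lam (t - s) ‖x - z‖) *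
              ENNReal.ofReal (A * PP d ((d : ℝ) + α) (2 * lam / 3) s ‖z - y‖) := by
              gcongr
              exact hQ s hs z
          _ ≤ _ := by
            rw [← ENNReal.ofReal_mul (by positivity), ← ENNReal.ofReal_add e1.le e2.le,
              ← ENNReal.ofReal_mul (by positivity)]
            apply ENNReal.ofReal_le_ofReal
            have := mul_le_mul_of_nonneg_left hk (show 0 ≤ C * A by positivity)
            linarith
    _ = ENNReal.ofReal (C * A * K * PP d ((d : ℝ) + α) (2 * lam / 3) t ‖x - y‖) *
        ((∫⁻ s in Ioo 0 t, ∫⁻ z, ENNReal.ofReal (PP d ((d : ℝ) + α) (lam / 3) (t - s) ‖x - z‖) ∂μ) +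
          ∫⁻ s in Ioo 0 t, ∫⁻ z, ENNReal.ofReal (PP d ((d : ℝ) + α) (lam / 3) s ‖y - z‖) ∂μ) := by
        rw [lint_const2 _ _ _ _ ENNReal.ofReal_ne_top, lint_add2]
        exact meas_PP d _ _ (by fun_prop) (by fun_prop)
    _ ≤ ENNReal.ofReal (C * A * K * PP d ((d : ℝ) + α) (2 * lam / 3) t ‖x - y‖) *
        (Nmu d α (lam / 3) μ t1 + Nmu d α (lam / 3) μ t1) := by
        gcongr
        · exact muU d α _ μ t t1 htt x
        · exact muS d α _ μ t t1 htt y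
    _ = _ := by
        rw [two_ofReal]
        congr 2; ring

lemma meas2 {E Z : Type*} [MeasurableSpace E] [MeasurableSpace Z]
    (ν : Measure Z) [SFinite ν]
    (t : ℝ) (k : E → ℝ → Z → ℝ≥0∞) (hk : Measurable (fun p : E × ℝ × Z => k p.1 p.2.1 p.2.2)) :
    Measurable (fun x => ∫⁻ s in Ioo 0 t, ∫⁻ z, k x s z ∂ν) := by
  have hm2 : Measurable (fun p : E × ℝ => ∫⁻ z, k p.1 p.2 z ∂ν) := by
    apply Measurable.lintegral_prod_right' (f := fun q : (E × ℝ) × Z => k q.1.1 q.1.2 q.2)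
    exact hk.comp (show Measurable (fun q : (E × ℝ) × Z => (q.1.1, q.1.2, q.2)) by fun_prop)
  exact Measurable.lintegral_prod_right' hm2

lemma mass_mu (d : ℕ) (α : ℝ) (hα : 0 < α) (hα2 : α < 2) (C lam : ℝ) (hC : 1 ≤ C) (hlam : 0 < lam) :
    ∃ K : ℝ, 0 < K ∧ ∀ (μ : Measure (EuclideanSpace ℝ (Fin d))) [SFinite μ] (t t1 : ℝ), 0 < t → t ≤ t1 → t1 ≤ 1 →
      ∀ (y : EuclideanSpace ℝ (Fin d)) (P : ℝ → EuclideanSpace ℝ (Fin d) → EuclideanSpace ℝ (Fin d) → ℝ)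
        (Q : ℝ → EuclideanSpace ℝ (Fin d) → ℝ≥0∞) (A : ℝ), 0 ≤ A →
        (∀ u ∈ Ioc (0 : ℝ) 1, ∀ x z, P u x z ≤ C * PP d ((d : ℝ) + α) lam u ‖x - z‖) →
        (∀ s ∈ Ioo (0 : ℝ) t, ∀ z, Q s z ≤ ENNReal.ofReal (A * PP d ((d : ℝ) + α) (2 * lam / 3) s ‖z - y‖)) →
        ∃ F : EuclideanSpace ℝ (Fin d) → ℝ≥0∞, Measurable F ∧
        (∀ x, ∫⁻ s in Ioo 0 t, ∫⁻ z, ENNReal.ofReal (P (t - s) x z) * Q s z ∂μ ≤ F x) ∧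
        ∫⁻ x, F x ≤ ENNReal.ofReal (K * A) * Nmu d α (lam / 3) μ t1 := by
  obtain ⟨K, hK, h⟩ := lint_PP d α lam hα hα2 hlam
  refine ⟨C * K, by positivity, ?_⟩
  intro μ _ t t1 ht htt ht1 y P Q A hA hP hQ
  refine ⟨fun x => ∫⁻ s in Ioo 0 t, ∫⁻ z, (ENNReal.ofReal C * ENNReal.ofReal (PP d ((d : ℝ) + α) lam (t - s) ‖x - z‖)) *
          (ENNReal.ofReal A * ENNReal.ofReal (PP d ((d : ℝ) + α) (lam / 3) s ‖y - z‖)) ∂μ, ?_, ?_, ?_⟩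
  · apply meas2 μ t (fun x s z => (ENNReal.ofReal C * ENNReal.ofReal (PP d ((d : ℝ) + α) lam (t - s) ‖x - z‖)) *
          (ENNReal.ofReal A * ENNReal.ofReal (PP d ((d : ℝ) + α) (lam / 3) s ‖y - z‖)))
    exact ((meas_PP d _ _ (by fun_prop) (by fun_prop)).const_mul _).mul
      ((meas_PP d _ _ (by fun_prop) (by fun_prop)).const_mul _)
  · intro x
    apply lint_mono2
    intro s hs z
    have hu : 0 < t - s := by linarith [hs.2]
    have hb := hP (t - s) ⟨hu, by linarith [hs.1]⟩ x z
    rw [← ENNReal.ofReal_mul (by positivity), ← ENNReal.ofReal_mul (by positivity)]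
    gcongr
    refine (hQ s hs z).trans (ENNReal.ofReal_le_ofReal ?_)
    rw [norm_sub_rev y z]
    gcongr
    unfold PP
    gcongr
    exact gg_anti hs.1 (by positivity) (by linarith) (norm_nonneg _) le_rfl

  calc _ ≤ (ENNReal.ofReal C * ENNReal.ofReal K) * ∫⁻ s in Ioo 0 t, ∫⁻ z,
          (ENNReal.ofReal A * ENNReal.ofReal (PP d ((d : ℝ) + α) (lam / 3) s ‖y - z‖)) ∂μ := by
        apply mass_gen volume μ t
          (fun x s z => ENNReal.ofReal C * ENNReal.ofReal (PP d ((d : ℝ) + α) lam (t - s) ‖x - z‖))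
        · exact (meas_PP d _ _ (by fun_prop) (by fun_prop)).const_mul _
        · exact (meas_PP d _ _ (by fun_prop) (by fun_prop)).const_mul _
        · exact ENNReal.mul_ne_top ENNReal.ofReal_ne_top ENNReal.ofReal_ne_top
        · intro s hs z
          rw [lintegral_const_mul' _ _ ENNReal.ofReal_ne_top]
          gcongr
          simp_rw [norm_sub_rev _ z]
          exact h (t - s) (by linarith [hs.2]) (by linarith [hs.1]) z
    _ ≤ _ := by
        rw [lint_const2 _ _ _ _ ENNReal.ofReal_ne_top, ← mul_assoc, ← ENNReal.ofReal_mul (by positivity),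
          ← ENNReal.ofReal_mul (by positivity)]
        gcongr
        exact muS d α _ μ t t1 htt y

lemma mass_G (d : ℕ) (α : ℝ) (hα : 0 < α) (hα2 : α < 2) (C lam Λ : ℝ) (hC : 1 ≤ C) (hlam : 0 < lam) (hΛ : 0 < Λ) :
    ∃ K : ℝ, 0 < K ∧ ∀ (t t1 : ℝ), 0 < t → t ≤ t1 → t1 ≤ 1 →
      ∀ (y : EuclideanSpace ℝ (Fin d)) (P : ℝ → EuclideanSpace ℝ (Fin d) → EuclideanSpace ℝ (Fin d) → ℝ)
        (Q : ℝ → EuclideanSpace ℝ (Fin d) → ℝ≥0∞) (A : ℝ)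
        (G c : EuclideanSpace ℝ (Fin d) → EuclideanSpace ℝ (Fin d) → ℝ), 0 ≤ A →
        Measurable (Function.uncurry G) → (∀ z w, 0 ≤ G z w) → (∀ z w, c z w ∈ Set.Icc (0 : ℝ) Λ) →
        (∀ u ∈ Ioc (0 : ℝ) 1, ∀ x z, P u x z ≤ C * PP d ((d : ℝ) + α) lam u ‖x - z‖) →
        (∀ s ∈ Ioo (0 : ℝ) t, ∀ z, Q s z ≤ ENNReal.ofReal (A * PP d ((d : ℝ) + α) (2 * lam / 3) s ‖z - y‖)) →
        ∫⁻ x, ∫⁻ s in Ioo 0 t, ∫⁻ zw : EuclideanSpace ℝ (Fin d) × EuclideanSpace ℝ (Fin d),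
          ENNReal.ofReal (P (t - s) x zw.1) * Q s zw.2 *
            ENNReal.ofReal (c zw.1 zw.2 * G zw.1 zw.2 / ‖zw.1 - zw.2‖ ^ ((d : ℝ) + α)) ≤
          ENNReal.ofReal (K * A) * NF d α (lam / 3) G t1 := by
  obtain ⟨K, hK, h⟩ := lint_PP d α lam hα hα2 hlam
  refine ⟨C * K * Λ, by positivity, ?_⟩
  intro t t1 ht htt ht1 y P Q A G c hA hGm hG hc hP hQ
  calc _ ≤ ∫⁻ x, ∫⁻ s in Ioo 0 t, ∫⁻ zw : EuclideanSpace ℝ (Fin d) × EuclideanSpace ℝ (Fin d),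
        (ENNReal.ofReal C * ENNReal.ofReal (PP d ((d : ℝ) + α) lam (t - s) ‖x - zw.1‖)) *
          (ENNReal.ofReal (A * Λ) * (ENNReal.ofReal (PP d ((d : ℝ) + α) (lam / 3) s ‖y - zw.2‖) *
            ENNReal.ofReal (G zw.1 zw.2 / ‖zw.1 - zw.2‖ ^ ((d : ℝ) + α)))) := by
        apply lintegral_mono
        intro x
        apply lint_mono2
        intro s hs zw
        have hu : 0 < t - s := by linarith [hs.2]
        have hb := hP (t - s) ⟨hu, by linarith [hs.1]⟩ x zw.1
        have hQ' : Q s zw.2 ≤ ENNReal.ofReal (A * PP d ((d : ℝ) + α) (lam / 3) s ‖y - zw.2‖) := by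
          refine (hQ s hs zw.2).trans (ENNReal.ofReal_le_ofReal ?_)
          rw [norm_sub_rev y zw.2]
          gcongr
          unfold PP
          gcongr
          exact gg_anti hs.1 (by positivity) (by linarith) (norm_nonneg _) le_rfl
        have hcG : c zw.1 zw.2 * G zw.1 zw.2 / ‖zw.1 - zw.2‖ ^ ((d : ℝ) + α) ≤
            Λ * (G zw.1 zw.2 / ‖zw.1 - zw.2‖ ^ ((d : ℝ) + α)) := by
          rw [mul_div_assoc]
          have := hG zw.1 zw.2
          gcongr
          exact (hc _ _).2
        calc _ ≤ ENNReal.ofReal (C * PP d ((d : ℝ) + α) lam (t - s) ‖x - zw.1‖) *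
              ENNReal.ofReal (A * PP d ((d : ℝ) + α) (lam / 3) s ‖y - zw.2‖) *
              ENNReal.ofReal (Λ * (G zw.1 zw.2 / ‖zw.1 - zw.2‖ ^ ((d : ℝ) + α))) := by gcongr
          _ = _ := by
            rw [ENNReal.ofReal_mul (by positivity), ENNReal.ofReal_mul (by positivity), ENNReal.ofReal_mul (by positivity),
              ENNReal.ofReal_mul (by positivity)]
            ring
    _ ≤ (ENNReal.ofReal C * ENNReal.ofReal K) * ∫⁻ s in Ioo 0 t, ∫⁻ zw : EuclideanSpace ℝ (Fin d) × EuclideanSpace ℝ (Fin d),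
          (ENNReal.ofReal (A * Λ) * (ENNReal.ofReal (PP d ((d : ℝ) + α) (lam / 3) s ‖y - zw.2‖) *
            ENNReal.ofReal (G zw.1 zw.2 / ‖zw.1 - zw.2‖ ^ ((d : ℝ) + α)))) := by
        apply mass_gen volume volume t
          (fun x s (zw : EuclideanSpace ℝ (Fin d) × EuclideanSpace ℝ (Fin d)) =>
            ENNReal.ofReal C * ENNReal.ofReal (PP d ((d : ℝ) + α) lam (t - s) ‖x - zw.1‖))
        · exact (meas_PP d _ _ (by fun_prop) (by fun_prop)).const_mul _
        · refine ((meas_PP d _ _ (by fun_prop) (by fun_prop)).mul ?_).const_mul _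
          exact ((hGm.comp measurable_snd).div (by fun_prop)).ennreal_ofReal
        · exact ENNReal.mul_ne_top ENNReal.ofReal_ne_top ENNReal.ofReal_ne_top
        · intro s hs z
          rw [lintegral_const_mul' _ _ ENNReal.ofReal_ne_top]
          gcongr
          simp_rw [norm_sub_rev _ z.1]
          exact h (t - s) (by linarith [hs.2]) (by linarith [hs.1]) z.1
    _ ≤ _ := by
        rw [lint_const2 _ _ _ _ ENNReal.ofReal_ne_top, ← mul_assoc, ← ENNReal.ofReal_mul (by positivity),
          ← ENNReal.ofReal_mul (by positivity), show C * K * (A * Λ) = C * K * Λ * A by ring]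
        gcongr
        exact GS d α _ G hG t t1 htt y

lemma jump_int (d : ℕ) (hd : 2 ≤ d) (α : ℝ) (hα : 0 < α) (hα2 : α < 2) (C lam Λ B : ℝ) (hC : 1 ≤ C) (hlam : 0 < lam)
    (hΛ : 0 < Λ) (hB : 0 ≤ B) :
    ∃ K : ℝ, 0 < K ∧ ∀ (t t1 : ℝ), 0 < t → t ≤ t1 → t1 ≤ 1 →
      ∀ (x y : EuclideanSpace ℝ (Fin d)) (P : ℝ → EuclideanSpace ℝ (Fin d) → ℝ)
        (Q : ℝ → EuclideanSpace ℝ (Fin d) → ℝ≥0∞) (A b δ : ℝ)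
        (G c : EuclideanSpace ℝ (Fin d) → EuclideanSpace ℝ (Fin d) → ℝ), 0 ≤ A → 0 ≤ b → 0 < δ → δ ≤ 1 →
        Measurable (Function.uncurry G) → (∀ z w, 0 ≤ G z w) → (∀ z w, G z w ≤ B) → (∀ z w, c z w ∈ Set.Icc (0 : ℝ) Λ) →
        (∀ u ∈ Ioc (0 : ℝ) 1, ∀ z, P u z ≤ C * PP d ((d : ℝ) + α) lam u ‖x - z‖) →
        (∀ s ∈ Ioo (0 : ℝ) t, ∀ z, Q s z ≤ ENNReal.ofReal (A * PP d ((d : ℝ) + α) (2 * lam / 3) s ‖z - y‖)) →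
        (∀ s ∈ Ioo (0 : ℝ) t, ∫⁻ z, Q s z ≤ ENNReal.ofReal b) →
        ∫⁻ s in Ioo 0 t, ∫⁻ zw : EuclideanSpace ℝ (Fin d) × EuclideanSpace ℝ (Fin d),
          ENNReal.ofReal (P (t - s) zw.1) * Q s zw.2 *
            ENNReal.ofReal (c zw.1 zw.2 * G zw.1 zw.2 / ‖zw.1 - zw.2‖ ^ ((d : ℝ) + α)) ≤
          ENNReal.ofReal (K * A * PP d ((d : ℝ) + α) (2 * lam / 3) t ‖x - y‖) * NF d α (lam / 3) G t1 +
          ENNReal.ofReal (K * (δ * A + δ⁻¹ * b) * PP d ((d : ℝ) + α) (2 * lam / 3) t ‖x - y‖) := by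
  obtain ⟨K, hK, h⟩ := step_pt d hd ((d : ℝ) + α) lam B (by positivity) hlam hB
  obtain ⟨K2, hK2, h2⟩ := lint_PP d α (lam / 3) hα hα2 (by positivity)
  refine ⟨2 * (C * Λ * K) + C * Λ * K * K2 * (K2 + 1), by positivity, ?_⟩
  intro t t1 ht htt ht1 x y P Q A b δ G c hA hb hδ hδ1 hGm hG hGB hc hP hQ hQb
  obtain ⟨β, hβ⟩ : ∃ β, β = (d : ℝ) + α := ⟨_, rfl⟩
  obtain ⟨PT, hPT⟩ : ∃ PT, PT = PP d ((d : ℝ) + α) (2 * lam / 3) t ‖x - y‖ := ⟨_, rfl⟩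
  have hPt : 0 < PT := by
    rw [hPT]; exact PP_pos (d := d) (β := (d : ℝ) + α) (c := 2 * lam / 3) ht (norm_nonneg (x - y))
  obtain ⟨HT, hHT⟩ : ∃ HT, HT = hh ((d : ℝ) + α) t ‖x - y‖ := ⟨_, rfl⟩
  have hHt : 0 < HT := by rw [hHT]; exact hh_pos ht (norm_nonneg _)
  have hHP : HT ≤ PT := by
    rw [hHT, hPT]; unfold PP; linarith [gg_nonneg (d := d) (c := 2 * lam / 3) (r := ‖x - y‖) ht]
  have hmG : Measurable (fun p : ℝ × EuclideanSpace ℝ (Fin d) × EuclideanSpace ℝ (Fin d) =>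
      ENNReal.ofReal (G p.2.1 p.2.2 / ‖p.2.1 - p.2.2‖ ^ ((d : ℝ) + α))) :=
    ((hGm.comp measurable_snd).div (by fun_prop)).ennreal_ofReal
  have hmf1 : Measurable (fun p : ℝ × EuclideanSpace ℝ (Fin d) × EuclideanSpace ℝ (Fin d) =>
      ENNReal.ofReal (PP d ((d : ℝ) + α) (lam / 3) (t - p.1) ‖x - p.2.1‖) *
        ENNReal.ofReal (G p.2.1 p.2.2 / ‖p.2.1 - p.2.2‖ ^ ((d : ℝ) + α))) :=
    (meas_PP d _ _ (by fun_prop) (by fun_prop)).mul hmG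
  have hmf2 : Measurable (fun p : ℝ × EuclideanSpace ℝ (Fin d) × EuclideanSpace ℝ (Fin d) =>
      ENNReal.ofReal (PP d ((d : ℝ) + α) (lam / 3) p.1 ‖y - p.2.2‖) *
        ENNReal.ofReal (G p.2.1 p.2.2 / ‖p.2.1 - p.2.2‖ ^ ((d : ℝ) + α))) :=
    (meas_PP d _ _ (by fun_prop) (by fun_prop)).mul hmG
  calc _ ≤ ∫⁻ s in Ioo 0 t, ∫⁻ zw : EuclideanSpace ℝ (Fin d) × EuclideanSpace ℝ (Fin d),
        (ENNReal.ofReal (C * Λ * K * A * PT) *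
          (ENNReal.ofReal (PP d ((d : ℝ) + α) (lam / 3) (t - s) ‖x - zw.1‖) *
            ENNReal.ofReal (G zw.1 zw.2 / ‖zw.1 - zw.2‖ ^ ((d : ℝ) + α)) +
          ENNReal.ofReal (PP d ((d : ℝ) + α) (lam / 3) s ‖y - zw.2‖) *
            ENNReal.ofReal (G zw.1 zw.2 / ‖zw.1 - zw.2‖ ^ ((d : ℝ) + α))) +
        ENNReal.ofReal (C * Λ * K * (HT / t)) *
          (ENNReal.ofReal (PP d ((d : ℝ) + α) (lam / 3) (t - s) ‖x - zw.1‖) *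
            (ENNReal.ofReal (δ * A * PP d ((d : ℝ) + α) (lam / 3) s ‖y - zw.2‖) + ENNReal.ofReal δ⁻¹ * Q s zw.2))) := by
        apply lint_mono2
        rintro s hs ⟨z, w⟩
        dsimp only
        have hu : 0 < t - s := by linarith [hs.2]
        have e1 := PP_pos (d := d) (β := (d : ℝ) + α) (c := lam / 3) hu (norm_nonneg (x - z))
        have e2 := PP_pos (d := d) (β := (d : ℝ) + α) (c := lam / 3) hs.1 (norm_nonneg (w - y))
        have e3 := PP_pos (d := d) (β := (d : ℝ) + α) (c := lam) hu (norm_nonneg (x - z))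
        have e4 := PP_pos (d := d) (β := (d : ℝ) + α) (c := 2 * lam / 3) hs.1 (norm_nonneg (w - y))
        have hbd := hP (t - s) ⟨hu, by linarith [hs.1]⟩ z
        have hQs := hQ s hs w
        have hQfin : Q s w ≠ ∞ := ne_top_of_le_ne_top ENNReal.ofReal_ne_top hQs
        obtain ⟨v, hv⟩ : ∃ v, v = (Q s w).toReal := ⟨_, rfl⟩
        have hQv : Q s w = ENNReal.ofReal v := by rw [hv, ENNReal.ofReal_toReal hQfin]
        have hv0 : 0 ≤ v := by rw [hv]; exact ENNReal.toReal_nonneg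
        rw [hQv] at hQs ⊢
        rw [ENNReal.ofReal_le_ofReal_iff (by positivity)] at hQs
        have hr : ‖x - y‖ ≤ ‖x - z‖ + ‖w - y‖ + ‖z - w‖ := by
          have a1 := norm_sub_le_norm_sub_add_norm_sub x z y
          have a2 := norm_sub_le_norm_sub_add_norm_sub z w y
          linarith
        have hk := h (t - s) s ‖x - z‖ ‖w - y‖ ‖x - y‖ ‖z - w‖ v A (G z w) δ hu hs.1 (norm_nonneg _) (norm_nonneg _)
          (norm_nonneg _) (norm_nonneg _) hr hv0 hA hQs (hG z w) (hGB z w) hδ hδ1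
        rw [sub_add_cancel, ← hPT, ← hHT] at hk
        rw [norm_sub_rev y w]
        have hgp : gg d (lam / 3) s ‖w - y‖ ≤ PP d ((d : ℝ) + α) (lam / 3) s ‖w - y‖ := by
          unfold PP; linarith [hh_pos (β := (d : ℝ) + α) hs.1 (norm_nonneg (w - y))]
        obtain ⟨g, hg⟩ : ∃ g, g = G z w / ‖z - w‖ ^ ((d : ℝ) + α) := ⟨_, rfl⟩
        have hg0 : 0 ≤ g := by
          rw [hg]; have := hG z w; positivity
        have hcG : c z w * G z w / ‖z - w‖ ^ ((d : ℝ) + α) ≤ Λ * g := by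
          rw [mul_div_assoc, ← hg]
          gcongr
          exact (hc _ _).2
        rw [← hg] at hk ⊢
        calc _ ≤ ENNReal.ofReal (C * PP d ((d : ℝ) + α) lam (t - s) ‖x - z‖) * ENNReal.ofReal v * ENNReal.ofReal (Λ * g) := by
              gcongr
          _ ≤ _ := by
            have f1 : 0 ≤ δ * A * PP d ((d : ℝ) + α) (lam / 3) s ‖w - y‖ := by positivity
            have f2 : 0 ≤ δ⁻¹ * v := by positivity
            rw [← ENNReal.ofReal_mul (by positivity), ← ENNReal.ofReal_mul (by positivity),
              ← ENNReal.ofReal_mul (by positivity), ← ENNReal.ofReal_mul (by positivity),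
              ← ENNReal.ofReal_add (by positivity) (by positivity), ← ENNReal.ofReal_mul (by positivity),
              ← ENNReal.ofReal_mul (by positivity), ← ENNReal.ofReal_add f1 f2, ← ENNReal.ofReal_mul (by positivity),
              ← ENNReal.ofReal_mul (by positivity), ← ENNReal.ofReal_add (by positivity) (by positivity)]
            apply ENNReal.ofReal_le_ofReal
            have k1 := mul_le_mul_of_nonneg_left hk (show 0 ≤ C * Λ by positivity)
            have k2 : C * Λ * (K * (HT / t) * PP d ((d : ℝ) + α) (lam / 3) (t - s) ‖x - z‖ *
                (δ * A * gg d (lam / 3) s ‖w - y‖ + δ⁻¹ * v)) ≤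
              C * Λ * (K * (HT / t) * PP d ((d : ℝ) + α) (lam / 3) (t - s) ‖x - z‖ *
                (δ * A * PP d ((d : ℝ) + α) (lam / 3) s ‖w - y‖ + δ⁻¹ * v)) := by gcongr
            linarith
    _ = ENNReal.ofReal (C * Λ * K * A * PT) *
          ((∫⁻ s in Ioo 0 t, ∫⁻ zw : EuclideanSpace ℝ (Fin d) × EuclideanSpace ℝ (Fin d),
            ENNReal.ofReal (PP d ((d : ℝ) + α) (lam / 3) (t - s) ‖x - zw.1‖) *
            ENNReal.ofReal (G zw.1 zw.2 / ‖zw.1 - zw.2‖ ^ ((d : ℝ) + α))) +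
          ∫⁻ s in Ioo 0 t, ∫⁻ zw : EuclideanSpace ℝ (Fin d) × EuclideanSpace ℝ (Fin d),
            ENNReal.ofReal (PP d ((d : ℝ) + α) (lam / 3) s ‖y - zw.2‖) *
            ENNReal.ofReal (G zw.1 zw.2 / ‖zw.1 - zw.2‖ ^ ((d : ℝ) + α))) +
        ENNReal.ofReal (C * Λ * K * (HT / t)) *
          ∫⁻ s in Ioo 0 t, ∫⁻ zw : EuclideanSpace ℝ (Fin d) × EuclideanSpace ℝ (Fin d),
          (ENNReal.ofReal (PP d ((d : ℝ) + α) (lam / 3) (t - s) ‖x - zw.1‖) *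
            (ENNReal.ofReal (δ * A * PP d ((d : ℝ) + α) (lam / 3) s ‖y - zw.2‖) + ENNReal.ofReal δ⁻¹ * Q s zw.2)) := by
        rw [lint_add2, lint_const2 _ _ _ _ ENNReal.ofReal_ne_top, lint_const2 _ _ _ _ ENNReal.ofReal_ne_top, lint_add2]
        · exact hmf1
        · exact (hmf1.add hmf2).const_mul _
    _ ≤ ENNReal.ofReal (C * Λ * K * A * PT) * (NF d α (lam / 3) G t1 + NF d α (lam / 3) G t1) +
        ENNReal.ofReal (C * Λ * K * (HT / t)) *
          (ENNReal.ofReal K2 * ENNReal.ofReal (δ * A * K2 + δ⁻¹ * b) * ENNReal.ofReal t) := by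
        gcongr
        · exact GU d α _ G hG t t1 htt x
        · exact GS d α _ G hG t t1 htt y
        · apply far_bd volume t (fun s z => ENNReal.ofReal (PP d ((d : ℝ) + α) (lam / 3) (t - s) ‖x - z‖))
            (fun s w => ENNReal.ofReal (δ * A * PP d ((d : ℝ) + α) (lam / 3) s ‖y - w‖) + ENNReal.ofReal δ⁻¹ * Q s w)
          · intro s hs
            exact h2 (t - s) (by linarith [hs.2]) (by linarith [hs.1]) x
          · intro s hs
            have hδA : 0 ≤ δ * A := by positivity
            simp_rw [ENNReal.ofReal_mul hδA]
            rw [lintegral_add_left ((meas_PP d _ _ (by fun_prop) (by fun_prop)).const_mul _),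
              lintegral_const_mul' _ _ ENNReal.ofReal_ne_top, lintegral_const_mul' _ _ ENNReal.ofReal_ne_top,
              ENNReal.ofReal_add (by positivity) (by positivity), ENNReal.ofReal_mul hδA,
              ENNReal.ofReal_mul (by positivity : 0 ≤ δ⁻¹)]
            gcongr
            · exact h2 s hs.1 (by linarith [hs.2]) y
            · exact hQb s hs
          · intro s
            exact meas_PP d _ _ (by fun_prop) (by fun_prop)
          · intro s hs z
            exact ENNReal.ofReal_ne_top
    _ ≤ _ := by
        rw [two_ofReal, ← ENNReal.ofReal_mul (by positivity), ← ENNReal.ofReal_mul (by positivity),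
          ← ENNReal.ofReal_mul (by positivity), ← hPT]
        refine add_le_add (mul_le_mul_left (ENNReal.ofReal_le_ofReal ?_) _) (ENNReal.ofReal_le_ofReal ?_)
        · rw [show 2 * (C * Λ * K * A * PT) = 2 * (C * Λ * K) * (A * PT) by ring]
          rw [mul_assoc _ A PT]
          gcongr
          have : 0 ≤ C * Λ * K * K2 * (K2 + 1) := by positivity
          linarith
        · have e : C * Λ * K * (HT / t) * (K2 * (δ * A * K2 + δ⁻¹ * b) * t) =
            C * Λ * K * K2 * (δ * A * K2 + δ⁻¹ * b) * HT := by field_simp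
          rw [e]
          have f1 : 0 ≤ δ * A := by positivity
          have f2 : 0 ≤ δ⁻¹ * b := by positivity
          have f3 : δ * A * K2 + δ⁻¹ * b ≤ (K2 + 1) * (δ * A + δ⁻¹ * b) := by nlinarith
          calc _ ≤ C * Λ * K * K2 * ((K2 + 1) * (δ * A + δ⁻¹ * b)) * PT := by gcongr
            _ = (C * Λ * K * K2 * (K2 + 1)) * (δ * A + δ⁻¹ * b) * PT := by ring
            _ ≤ _ := by
              gcongr
              have : 0 ≤ 2 * (C * Λ * K) := by positivity
              linarith

lemma main_aux (d : ℕ) (hd : 2 ≤ d) (α : ℝ) (hα1 : 0 < α) (hα2 : α < 2)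
    (C lam Λ B : ℝ) (hC : 1 ≤ C) (hlam : 0 < lam) (hΛ : 0 < Λ) (hB : 0 ≤ B) :
    ∃ M σ A : ℝ, 1 ≤ M ∧ 0 < σ ∧ 0 < A ∧
      ∀ p : ℝ → EuclideanSpace ℝ (Fin d) → EuclideanSpace ℝ (Fin d) → ℝ,
        (∀ t ∈ Set.Ioc (0 : ℝ) 1, ∀ x y,
          p t x y ≤ C * PP d ((d : ℝ) + α) lam t ‖x - y‖) →
        ∀ (μ : Measure (EuclideanSpace ℝ (Fin d)))
          (G : EuclideanSpace ℝ (Fin d) → EuclideanSpace ℝ (Fin d) → ℝ),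
          Measurable (Function.uncurry G) → (∀ z w, 0 ≤ G z w) → (∀ z w, G z w ≤ B) →
          ∀ c : EuclideanSpace ℝ (Fin d) → EuclideanSpace ℝ (Fin d) → ℝ,
            (∀ z w, c z w ∈ Set.Icc (0 : ℝ) Λ) →
            ∀ q : ℕ → ℝ → EuclideanSpace ℝ (Fin d) → EuclideanSpace ℝ (Fin d) → ℝ≥0∞,
              (∀ t x y, q 0 t x y = ENNReal.ofReal (p t x y)) →
              (∀ k t x y, q (k + 1) t x y =
                (∫⁻ s in Set.Ioc (0 : ℝ) t, ∫⁻ z,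
                    ENNReal.ofReal (p (t - s) x z) * q k s z y ∂μ) +
                ∫⁻ s in Set.Ioc (0 : ℝ) t,
                  ∫⁻ zw : EuclideanSpace ℝ (Fin d) × EuclideanSpace ℝ (Fin d),
                    ENNReal.ofReal (p (t - s) x zw.1) * q k s zw.2 y *
                      ENNReal.ofReal (c zw.1 zw.2 * G zw.1 zw.2 /
                        ‖zw.1 - zw.2‖ ^ ((d : ℝ) + α))) →
              ∀ t₁ ∈ Set.Ioc (0 : ℝ) 1,
                Nmu d α (lam / 3) μ t₁ + NF d α (lam / 3) G t₁
                    ≤ ENNReal.ofReal (1 / (2 * M)) →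
                ∀ k : ℕ, (∀ t ∈ Set.Ioc (0 : ℝ) t₁, ∀ x y,
                    q k t x y ≤ ENNReal.ofReal (A * (1 / 2) ^ k * PP d ((d : ℝ) + α) (2 * lam / 3) t ‖x - y‖)) ∧
                  (∀ t ∈ Set.Ioc (0 : ℝ) t₁, ∀ y, ∫⁻ x, q k t x y ≤ ENNReal.ofReal (σ * (A * (1 / 2) ^ k))) := by
  obtain ⟨K1, hK1, h1⟩ := near_int d hd α hα1 C lam hC hlam
  obtain ⟨K2, hK2, h2⟩ := jump_int d hd α hα1 hα2 C lam Λ B hC hlam hΛ hB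
  obtain ⟨K3, hK3, h3⟩ := mass_mu d α hα1 hα2 C lam hC hlam
  obtain ⟨K4, hK4, h4⟩ := mass_G d α hα1 hα2 C lam Λ hC hlam hΛ
  obtain ⟨K5, hK5, h5⟩ := lint_PP d α lam hα1 hα2 hlam
  obtain ⟨K, hK⟩ : ∃ K, K = K1 + K2 + K3 + K4 + 1 := ⟨_, rfl⟩
  have hK0 : 1 ≤ K := by rw [hK]; linarith
  obtain ⟨δ, hδ⟩ : ∃ δ, δ = 1 / (8 * K) := ⟨_, rfl⟩
  have hδ0 : 0 < δ := by rw [hδ]; positivity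
  have hKδ : K * δ = 1 / 8 := by rw [hδ]; field_simp
  have hδ1 : δ ≤ 1 := by nlinarith
  obtain ⟨N, hN⟩ : ∃ N, N = δ ^ 2 / (4 * K) := ⟨_, rfl⟩
  have hN0 : 0 < N := by rw [hN]; positivity
  have hKN : K * N = δ ^ 2 / 4 := by rw [hN]; field_simp
  refine ⟨2 * K / δ ^ 2, δ ^ 2, C + C * K5 / δ ^ 2, ?_, by positivity, by positivity, ?_⟩
  · rw [le_div_iff₀ (by positivity)]; nlinarith
  intro p hp μ G hGm hG hGB c hc q hq0 hqs t₁ ht₁ hNN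
  have hM : 1 / (2 * (2 * K / δ ^ 2)) = N := by rw [hN]; field_simp; norm_num
  rw [hM] at hNN
  have hNmu : Nmu d α (lam / 3) μ t₁ ≤ ENNReal.ofReal N := le_self_add.trans hNN
  have hNF : NF d α (lam / 3) G t₁ ≤ ENNReal.ofReal N := le_add_self.trans hNN
  have : SFinite μ := Nmu_sfinite d α (lam / 3) hα1 μ t₁ ht₁.1 (ne_top_of_le_ne_top ENNReal.ofReal_ne_top hNmu)
  obtain ⟨A, hA⟩ : ∃ A, A = C + C * K5 / δ ^ 2 := ⟨_, rfl⟩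
  have hA0 : 0 < A := by rw [hA]; positivity
  rw [← hA]
  simp_rw [← restrict_Ioo_eq_restrict_Ioc] at hqs
  intro k
  induction k with
  | zero =>
    constructor
    · intro t ht x y
      rw [hq0]
      apply ENNReal.ofReal_le_ofReal
      refine (hp t ⟨ht.1, ht.2.trans ht₁.2⟩ x y).trans ?_
      have e1 : C ≤ A * (1 / 2) ^ 0 := by
        rw [hA]; have : 0 ≤ C * K5 / δ ^ 2 := by positivity
        simp; linarith
      have e2 : PP d ((d : ℝ) + α) lam t ‖x - y‖ ≤ PP d ((d : ℝ) + α) (2 * lam / 3) t ‖x - y‖ := by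
        unfold PP
        gcongr
        exact gg_anti ht.1 (by positivity) (by linarith) (norm_nonneg _) le_rfl
      have e3 := PP_pos (d := d) (β := (d : ℝ) + α) (c := lam) ht.1 (norm_nonneg (x - y))
      gcongr
    · intro t ht y
      simp_rw [hq0]
      calc _ ≤ ∫⁻ x, ENNReal.ofReal C * ENNReal.ofReal (PP d ((d : ℝ) + α) lam t ‖y - x‖) := by
            apply lintegral_mono
            intro x
            dsimp only
            rw [← ENNReal.ofReal_mul (by positivity), norm_sub_rev y x]
            exact ENNReal.ofReal_le_ofReal (hp t ⟨ht.1, ht.2.trans ht₁.2⟩ x y)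
        _ ≤ ENNReal.ofReal C * ENNReal.ofReal K5 := by
            rw [lintegral_const_mul' _ _ ENNReal.ofReal_ne_top]
            gcongr
            exact h5 t ht.1 (ht.2.trans ht₁.2) y
        _ ≤ _ := by
            rw [← ENNReal.ofReal_mul (by positivity)]
            apply ENNReal.ofReal_le_ofReal
            rw [hA]
            have : δ ^ 2 * ((C + C * K5 / δ ^ 2) * (1 / 2) ^ 0) = δ ^ 2 * C + C * K5 := by
              field_simp
            rw [this]
            have : 0 ≤ δ ^ 2 * C := by positivity
            linarith
  | succ k ih =>
    obtain ⟨ih1, ih2⟩ := ih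
    obtain ⟨a, ha⟩ : ∃ a, a = A * (1 / 2) ^ k := ⟨_, rfl⟩
    have ha0 : 0 < a := by rw [ha]; positivity
    have hak : A * (1 / 2) ^ (k + 1) = a / 2 := by rw [ha]; ring
    rw [hak]
    rw [← ha] at ih1 ih2
    constructor
    · intro t ht x y
      have hsub : ∀ s ∈ Ioo 0 t, s ∈ Ioc 0 t₁ := fun s hs => ⟨hs.1, hs.2.le.trans ht.2⟩
      have n1 := h1 μ t t₁ ht.1 ht.2 ht₁.2 x y (fun u z => p u x z) (fun s z => q k s z y) a ha0.le
        (fun u hu z => hp u hu x z) (fun s hs z => ih1 s (hsub s hs) z y)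
      have n2 := h2 t t₁ ht.1 ht.2 ht₁.2 x y (fun u z => p u x z) (fun s z => q k s z y) a (δ ^ 2 * a) δ G c ha0.le
        (by positivity) hδ0 hδ1 hGm hG hGB hc (fun u hu z => hp u hu x z) (fun s hs z => ih1 s (hsub s hs) z y)
        (fun s hs => ih2 s (hsub s hs) y)
      rw [hqs]
      refine (add_le_add n1 n2).trans ?_
      obtain ⟨T, hT⟩ : ∃ T, T = PP d ((d : ℝ) + α) (2 * lam / 3) t ‖x - y‖ := ⟨_, rfl⟩
      have hT0 : 0 < T := by
        rw [hT]; exact PP_pos (d := d) (β := (d : ℝ) + α) (c := 2 * lam / 3) ht.1 (norm_nonneg (x - y))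
      rw [← hT]
      calc _ ≤ ENNReal.ofReal (K1 * a * T) * ENNReal.ofReal N + (ENNReal.ofReal (K2 * a * T) * ENNReal.ofReal N +
            ENNReal.ofReal (K2 * (δ * a + δ⁻¹ * (δ ^ 2 * a)) * T)) :=
            add_le_add (mul_le_mul_right hNmu _) (add_le_add (mul_le_mul_right hNF _) le_rfl)
        _ ≤ _ := by
          rw [← ENNReal.ofReal_mul (by positivity), ← ENNReal.ofReal_mul (by positivity),
            ← ENNReal.ofReal_add (by positivity) (by positivity), ← ENNReal.ofReal_add (by positivity) (by positivity)]
          apply ENNReal.ofReal_le_ofReal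
          have e1 : δ⁻¹ * (δ ^ 2 * a) = δ * a := by field_simp
          rw [e1]
          have e2 : K1 * a * T * N + (K2 * a * T * N + K2 * (δ * a + δ * a) * T) =
            ((K1 + K2) * N + 2 * (K2 * δ)) * (a * T) := by ring
          have e3 : (K1 + K2) * N ≤ K * N := by gcongr; rw [hK]; linarith
          have e4 : K2 * δ ≤ K * δ := by gcongr; rw [hK]; linarith
          rw [e2, show a / 2 * T = (1 / 2) * (a * T) by ring]
          gcongr
          nlinarith
    · intro t ht y
      have hsub : ∀ s ∈ Ioo 0 t, s ∈ Ioc 0 t₁ := fun s hs => ⟨hs.1, hs.2.le.trans ht.2⟩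
      obtain ⟨F, hFm, hF, n1⟩ := h3 μ t t₁ ht.1 ht.2 ht₁.2 y p (fun s z => q k s z y) a ha0.le
        hp (fun s hs z => ih1 s (hsub s hs) z y)
      have n2 := h4 t t₁ ht.1 ht.2 ht₁.2 y p (fun s z => q k s z y) a G c ha0.le
        hGm hG hc hp (fun s hs z => ih1 s (hsub s hs) z y)
      calc _ ≤ ∫⁻ x, (F x + ∫⁻ s in Ioo 0 t, ∫⁻ zw : EuclideanSpace ℝ (Fin d) × EuclideanSpace ℝ (Fin d),
              ENNReal.ofReal (p (t - s) x zw.1) * q k s zw.2 y *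
                ENNReal.ofReal (c zw.1 zw.2 * G zw.1 zw.2 / ‖zw.1 - zw.2‖ ^ ((d : ℝ) + α))) := by
            apply lintegral_mono
            intro x
            dsimp only
            rw [hqs]
            exact add_le_add (hF x) le_rfl
        _ ≤ ENNReal.ofReal (K3 * a) * ENNReal.ofReal N + ENNReal.ofReal (K4 * a) * ENNReal.ofReal N := by
            rw [lintegral_add_left hFm]
            exact add_le_add (n1.trans (mul_le_mul_right hNmu _)) (n2.trans (mul_le_mul_right hNF _))
        _ ≤ _ := by
            rw [← ENNReal.ofReal_mul (by positivity), ← ENNReal.ofReal_mul (by positivity),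
              ← ENNReal.ofReal_add (by positivity) (by positivity)]
            apply ENNReal.ofReal_le_ofReal
            have e3 : (K3 + K4) * N ≤ K * N := by gcongr; rw [hK]; linarith
            have e5 : (K3 + K4) * N ≤ δ ^ 2 / 2 := by
              have : 0 ≤ δ ^ 2 := by positivity
              linarith
            calc K3 * a * N + K4 * a * N = (K3 + K4) * N * a := by ring
              _ ≤ δ ^ 2 / 2 * a := by gcongr
              _ = _ := by ring

/-- convergence and bound for the series Σ q⁽ᵏ⁾ on (0, t₁];
the constants `M`, `γ` depend only on d, α, C, λ, Λ and the sup-norm bound `B` of `G`.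
In `ℝ≥0∞` the stated bound by the finite right-hand side also expresses the
convergence of the series. -/
theorem stmt19 (d : ℕ) (hd : 2 ≤ d) (α : ℝ) (hα1 : 0 < α) (hα2 : α < 2)
    (C lam Λ B : ℝ) (hC : 1 ≤ C) (hlam : 0 < lam) (hΛ : 0 < Λ) (hB : 0 ≤ B) :
    ∃ M γ : ℝ, 1 ≤ M ∧ 0 < γ ∧
      ∀ p : ℝ → EuclideanSpace ℝ (Fin d) → EuclideanSpace ℝ (Fin d) → ℝ,
        Measurable (fun q : ℝ × EuclideanSpace ℝ (Fin d) × EuclideanSpace ℝ (Fin d) =>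
          p q.1 q.2.1 q.2.2) →
        (∀ t ∈ Set.Ioc (0 : ℝ) 1, ∀ x y, 0 ≤ p t x y) →
        (∀ t ∈ Set.Ioc (0 : ℝ) 1, ∀ x y,
          p t x y ≤ C * (Gam d lam t (x - y) + eta d α t (x - y))) →
        ∀ (μ : Measure (EuclideanSpace ℝ (Fin d)))
          (G : EuclideanSpace ℝ (Fin d) → EuclideanSpace ℝ (Fin d) → ℝ),
          Measurable (Function.uncurry G) → (∀ z w, 0 ≤ G z w) → (∀ z w, G z w ≤ B) →
          ∀ c : EuclideanSpace ℝ (Fin d) → EuclideanSpace ℝ (Fin d) → ℝ,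
            Measurable (Function.uncurry c) → (∀ z w, c z w ∈ Set.Icc (0 : ℝ) Λ) →
            ∀ q : ℕ → ℝ → EuclideanSpace ℝ (Fin d) → EuclideanSpace ℝ (Fin d) → ℝ≥0∞,
              (∀ t x y, q 0 t x y = ENNReal.ofReal (p t x y)) →
              (∀ k t x y, q (k + 1) t x y =
                (∫⁻ s in Set.Ioc (0 : ℝ) t, ∫⁻ z,
                    ENNReal.ofReal (p (t - s) x z) * q k s z y ∂μ) +
                ∫⁻ s in Set.Ioc (0 : ℝ) t,
                  ∫⁻ zw : EuclideanSpace ℝ (Fin d) × EuclideanSpace ℝ (Fin d),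
                    ENNReal.ofReal (p (t - s) x zw.1) * q k s zw.2 y *
                      ENNReal.ofReal (c zw.1 zw.2 * G zw.1 zw.2 /
                        ‖zw.1 - zw.2‖ ^ ((d : ℝ) + α))) →
              ∀ t₁ ∈ Set.Ioc (0 : ℝ) 1,
                Nmu d α (lam / 3) μ t₁ + NF d α (lam / 3) G t₁
                    ≤ ENNReal.ofReal (1 / (2 * M)) →
                ∀ t ∈ Set.Ioc (0 : ℝ) t₁, ∀ x y : EuclideanSpace ℝ (Fin d),
                  (∑' k : ℕ, q k t x y)
                    ≤ ENNReal.ofReal (γ * pc d α (2 * lam / 3) t x y) := by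
  obtain ⟨M, σ, A, hM, hσ, hA, h⟩ := main_aux d hd α hα1 hα2 C lam Λ B hC hlam hΛ hB
  refine ⟨M, 2 * A, hM, by positivity, ?_⟩
  intro p _ _ hp μ G hGm hG hGB c _ hc q hq0 hqs t₁ ht₁ hNN t ht x y
  have hk := fun k => (h p hp μ G hGm hG hGB c hc q hq0 hqs t₁ ht₁ hNN k).1 t ht x y
  obtain ⟨T, hT⟩ : ∃ T, T = PP d ((d : ℝ) + α) (2 * lam / 3) t ‖x - y‖ := ⟨_, rfl⟩
  have hT0 : 0 < T := by
    rw [hT]; exact PP_pos (d := d) (β := (d : ℝ) + α) (c := 2 * lam / 3) ht.1 (norm_nonneg (x - y))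
  have hpc : pc d α (2 * lam / 3) t x y = T := by rw [hT]; rfl
  rw [hpc]
  simp_rw [← hT] at hk
  have hs : HasSum (fun k : ℕ => A * (1 / 2) ^ k * T) (A * 2 * T) :=
    (hasSum_geometric_two.mul_left A).mul_right T
  calc _ ≤ ∑' k : ℕ, ENNReal.ofReal (A * (1 / 2) ^ k * T) := ENNReal.tsum_le_tsum hk
    _ = ENNReal.ofReal (A * 2 * T) := by
        rw [← ENNReal.ofReal_tsum_of_nonneg (fun k => by positivity) hs.summable, hs.tsum_eq]
    _ = _ := by congr 1; ring
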